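/- Let τ(n) denote the number of divisors of n, γ the Euler–Mascheroni constant, and for y ≥ 1 set Δ(y) := Σ_{n≤y} τ(n) − y log y − (2γ − 1)y. Then for every ε > 0 there exists a constant C_ε > 0 such that for all real x ≥ 1 and all integers N with 1 ≤ N ≤ x²: |Δ(x²) − (√x / (π√2)) Σ_{n≤N} τ(n) n^{−3/4} cos(4π √n x − π/4)| ≤ C_ε N^{−1/2} x^{1+ε}. -/

import Mathlib

open Real

/-- The error term in the Dirichlet divisor problem:
`Δ(y) := Σ_{n≤y} τ(n) − y log y − (2γ−1) y`. -/
noncomputable def divisorError (y : ℝ) : ℝ :=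
  (∑ n ∈ Finset.Icc 1 ⌊y⌋₊, ((Nat.divisors n).card : ℝ)) -
    y * Real.log y - (2 * Real.eulerMascheroniConstant - 1) * y

/-- First derivative test for oscillatory integrals, with the amplitude written as `g * φ'`. -/
theorem norm_integral_oscillatory_le {a b : ℝ} (hab : a ≤ b) {φ φ' g g' : ℝ → ℝ}
    (hφ : ∀ t ∈ Set.Icc a b, HasDerivAt φ (φ' t) t)
    (hg : ∀ t ∈ Set.Icc a b, HasDerivAt g (g' t) t)
    (hφc : ContinuousOn φ' (Set.Icc a b)) (hgc : ContinuousOn g' (Set.Icc a b))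
    (hmono : (∀ t ∈ Set.Icc a b, 0 ≤ g' t) ∨ (∀ t ∈ Set.Icc a b, g' t ≤ 0)) :
    ‖∫ t in a..b, ((g t * φ' t : ℝ) : ℂ) * Complex.exp (Complex.I * φ t)‖
      ≤ 2 * (|g a| + |g b|) := by
  have hu : Set.uIcc a b = Set.Icc a b := Set.uIcc_of_le hab
  have hv : ∀ t ∈ Set.Icc a b, HasDerivAt (fun t => -Complex.I * Complex.exp (Complex.I * φ t))
      ((φ' t : ℂ) * Complex.exp (Complex.I * φ t)) t := by
    intro t ht
    have h1 := (((hφ t ht).ofReal_comp.const_mul Complex.I).cexp).const_mul (-Complex.I)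
    refine h1.congr_deriv ?_
    linear_combination (-(φ' t : ℂ) * Complex.exp (Complex.I * φ t)) * Complex.I_sq
  have hec : ContinuousOn (fun t => Complex.exp (Complex.I * φ t)) (Set.Icc a b) := by
    have : ContinuousOn φ (Set.Icc a b) := fun t ht => (hφ t ht).continuousAt.continuousWithinAt
    fun_prop
  have hφc' : ContinuousOn (fun t => (φ' t : ℂ)) (Set.Icc a b) :=
    Complex.continuous_ofReal.comp_continuousOn hφc
  have hgc' : ContinuousOn (fun t => (g' t : ℂ)) (Set.Icc a b) :=
    Complex.continuous_ofReal.comp_continuousOn hgc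
  have key := intervalIntegral.integral_mul_deriv_eq_deriv_mul (a := a) (b := b)
    (u := fun t => (g t : ℂ)) (u' := fun t => (g' t : ℂ))
    (v := fun t => -Complex.I * Complex.exp (Complex.I * φ t))
    (v' := fun t => (φ' t : ℂ) * Complex.exp (Complex.I * φ t))
    (fun t ht => (hg t (hu ▸ ht)).ofReal_comp) (fun t ht => hv t (hu ▸ ht))
    (ContinuousOn.intervalIntegrable (by rwa [hu]))
    (ContinuousOn.intervalIntegrable (by rw [hu]; exact hφc'.mul hec))
  have hnv : ∀ t, ‖-Complex.I * Complex.exp (Complex.I * φ t)‖ = 1 := by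
    intro t
    rw [norm_mul, mul_comm Complex.I, Complex.norm_exp_ofReal_mul_I]
    simp
  have hrest : ‖∫ t in a..b, (g' t : ℂ) * (-Complex.I * Complex.exp (Complex.I * φ t))‖
      ≤ |g b - g a| := by
    have hintg : IntervalIntegrable g' MeasureTheory.volume a b :=
      ContinuousOn.intervalIntegrable (by rwa [hu])
    have hsub : ∫ t in a..b, g' t = g b - g a :=
      intervalIntegral.integral_eq_sub_of_hasDerivAt (fun t ht => hg t (hu ▸ ht)) hintg
    have h1 : ‖∫ t in a..b, (g' t : ℂ) * (-Complex.I * Complex.exp (Complex.I * φ t))‖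
        ≤ ∫ t in a..b, |g' t| := by
      refine (intervalIntegral.norm_integral_le_integral_norm hab).trans (le_of_eq ?_)
      refine intervalIntegral.integral_congr fun t _ => ?_
      simp only [norm_mul (g' t : ℂ), hnv, mul_one, Complex.norm_real, Real.norm_eq_abs]
    refine h1.trans ?_
    rcases hmono with h | h
    · rw [intervalIntegral.integral_congr (g := g')
        (fun t ht => abs_of_nonneg (h t (hu ▸ ht))), hsub]
      exact le_abs_self _
    · rw [intervalIntegral.integral_congr (g := fun t => -g' t)
        (fun t ht => abs_of_nonpos (h t (hu ▸ ht))), intervalIntegral.integral_neg, hsub]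
      exact neg_le_abs _
  have hcongr : ∫ t in a..b, ((g t * φ' t : ℝ) : ℂ) * Complex.exp (Complex.I * φ t)
      = ∫ t in a..b, (g t : ℂ) * ((φ' t : ℂ) * Complex.exp (Complex.I * φ t)) := by
    congr 1; ext t; push_cast; ring
  rw [hcongr, key]
  refine (norm_sub_le _ _).trans ?_
  have h2 := norm_sub_le ((g b : ℂ) * (-Complex.I * Complex.exp (Complex.I * φ b)))
    ((g a : ℂ) * (-Complex.I * Complex.exp (Complex.I * φ a)))
  rw [norm_mul (g b : ℂ), norm_mul (g a : ℂ), hnv, hnv, Complex.norm_real, Complex.norm_real,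
    Real.norm_eq_abs, Real.norm_eq_abs] at h2
  have h3 := abs_sub (g b) (g a)
  linarith

/-- The Dirichlet kernel. -/
theorem sin_mul_dirichlet_kernel (K : ℕ) (s : ℝ) :
    sin (π * s) * (1 + ∑ k ∈ Finset.Icc 1 K, 2 * cos (2 * π * k * s)) =
      sin ((2 * K + 1) * π * s) := by
  induction K with
  | zero => simp
  | succ K ih =>
    rw [Finset.sum_Icc_succ_top (by lia), ← add_assoc, mul_add, ih]
    have h1 : (2 * ((K + 1 : ℕ) : ℝ) + 1) * π * s = 2 * π * ((K + 1 : ℕ) : ℝ) * s + π * s := by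
      push_cast; ring
    have h2 : (2 * (K : ℝ) + 1) * π * s = 2 * π * ((K + 1 : ℕ) : ℝ) * s - π * s := by
      push_cast; ring
    rw [h1, h2, sin_add, sin_sub]
    ring

/-- The `K`-th partial sum of `∑ sin (2πkt) / (πk)`, the Fourier series of `1/2 - {t}`. -/
noncomputable def sawtoothSum (K : ℕ) (t : ℝ) : ℝ :=
  ∑ k ∈ Finset.Icc 1 K, sin (2 * π * k * t) / (π * k)

/-- The truncation error of the Fourier expansion of the sawtooth function `{t} - 1/2`. -/
noncomputable def sawtoothError (K : ℕ) (t : ℝ) : ℝ :=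
  Int.fract t - 1 / 2 + sawtoothSum K t

theorem hasDerivAt_sawtoothSum (K : ℕ) (t : ℝ) :
    HasDerivAt (sawtoothSum K) (∑ k ∈ Finset.Icc 1 K, 2 * cos (2 * π * k * t)) t := by
  unfold sawtoothSum
  refine HasDerivAt.fun_sum fun k hk => ?_
  have hk0 : (k : ℝ) ≠ 0 := by
    have := (Finset.mem_Icc.mp hk).1
    positivity
  have h := (((hasDerivAt_id t).const_mul (2 * π * k)).sin).div_const (π * k)
  refine h.congr_deriv ?_
  simp only [id]
  field_simp

theorem sawtoothSum_add_int (K : ℕ) (t : ℝ) (n : ℤ) :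
    sawtoothSum K (t + n) = sawtoothSum K t := by
  unfold sawtoothSum
  refine Finset.sum_congr rfl fun k _ => ?_
  have : 2 * π * k * (t + n) = 2 * π * k * t + ((k * n : ℤ) : ℝ) * (2 * π) := by
    push_cast; ring
  rw [this, sin_add_int_mul_two_pi]

theorem sawtoothSum_neg (K : ℕ) (t : ℝ) : sawtoothSum K (-t) = -sawtoothSum K t := by
  unfold sawtoothSum
  rw [← Finset.sum_neg_distrib]
  refine Finset.sum_congr rfl fun k _ => ?_
  rw [mul_neg, sin_neg, neg_div]

theorem sawtoothSum_half (K : ℕ) : sawtoothSum K (1 / 2) = 0 := by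
  unfold sawtoothSum
  refine Finset.sum_eq_zero fun k _ => ?_
  rw [show 2 * π * k * (1 / 2) = k * π by ring, sin_nat_mul_pi, zero_div]

theorem abs_sawtoothSum_le (K : ℕ) (t : ℝ) : |sawtoothSum K t| ≤ 2 * K * |t| := by
  unfold sawtoothSum
  refine (Finset.abs_sum_le_sum_abs _ _).trans ?_
  have : ∀ k ∈ Finset.Icc 1 K, |sin (2 * π * k * t) / (π * k)| ≤ 2 * |t| := by
    intro k hk
    have hk0 : (0 : ℝ) < k := by
      have := (Finset.mem_Icc.mp hk).1
      positivity
    have hpk : 0 < π * k := by positivity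
    rw [abs_div, abs_of_pos hpk, div_le_iff₀ hpk]
    refine abs_sin_le_abs.trans (le_of_eq ?_)
    rw [abs_mul, abs_of_pos (by positivity)]
    ring
  refine (Finset.sum_le_sum this).trans ?_
  simp
  linarith

theorem abs_sawtooth_mul_le {K : ℕ} {d : ℝ} (hd : 0 < d) (hd' : d ≤ 1 / 2) :
    |d - 1 / 2 + sawtoothSum K d| * ((K + 1) * d) ≤ 1 := by
  set c : ℝ := (2 * K + 1) * π with hc
  have hcpos : 0 < c := by positivity
  have hsin : ∀ s ∈ Set.Icc d (1 / 2), 0 < sin (π * s) := fun s hs =>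
    sin_pos_of_pos_of_lt_pi (mul_pos pi_pos (hd.trans_le hs.1))
      (by have := hs.2; nlinarith [pi_pos])
  have hosc := norm_integral_oscillatory_le hd' (φ := fun s => c * s) (φ' := fun _ => c)
    (g := fun s => (c * sin (π * s))⁻¹)
    (g' := fun s => -(c * (cos (π * s) * π)) / (c * sin (π * s)) ^ 2)
    (fun s _ => by simpa using (hasDerivAt_id s).const_mul c)
    (fun s hs => by
      have h := (((hasDerivAt_id s).const_mul π).sin.const_mul c).fun_inv
        (mul_pos hcpos (hsin s hs)).ne'
      simpa using h)
    continuousOn_const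
    (by
      refine ContinuousOn.div (by fun_prop) (by fun_prop) fun s hs => ?_
      exact (pow_pos (mul_pos hcpos (hsin s hs)) 2).ne')
    (Or.inr fun s hs => by
      have hcos : 0 ≤ cos (π * s) := cos_nonneg_of_mem_Icc
        ⟨by have := hs.1; nlinarith [pi_pos], by have := hs.2; nlinarith [pi_pos]⟩
      rw [neg_div]
      exact neg_nonpos.mpr (by positivity))
  have hintg : ∫ s in d..(1 / 2), (1 + ∑ k ∈ Finset.Icc 1 K, 2 * cos (2 * π * k * s))
      = -(d - 1 / 2 + sawtoothSum K d) := by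
    have hD : ∀ s : ℝ, HasDerivAt (fun s => s - 1 / 2 + sawtoothSum K s)
        (1 + ∑ k ∈ Finset.Icc 1 K, 2 * cos (2 * π * k * s)) s := fun s =>
      ((hasDerivAt_id s).sub_const _).add (hasDerivAt_sawtoothSum K s)
    rw [intervalIntegral.integral_eq_sub_of_hasDerivAt (fun s _ => hD s)
      (Continuous.intervalIntegrable (by fun_prop) _ _), sawtoothSum_half]
    ring
  have him : ∫ s in d..(1 / 2), (1 + ∑ k ∈ Finset.Icc 1 K, 2 * cos (2 * π * k * s))
      = (∫ s in d..(1 / 2), (((c * sin (π * s))⁻¹ * c : ℝ) : ℂ) *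
          Complex.exp (Complex.I * (c * s : ℝ))).im := by
    have hcont : ContinuousOn (fun s : ℝ => (((c * sin (π * s))⁻¹ * c : ℝ) : ℂ) *
        Complex.exp (Complex.I * (c * s : ℝ))) (Set.uIcc d (1 / 2)) := by
      rw [Set.uIcc_of_le hd']
      refine ContinuousOn.mul (Complex.continuous_ofReal.comp_continuousOn ?_) (by fun_prop)
      refine ContinuousOn.mul (ContinuousOn.inv₀ (by fun_prop) fun s hs => ?_) continuousOn_const
      exact (mul_pos hcpos (hsin s hs)).ne'
    have := Complex.imCLM.intervalIntegral_comp_comm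
      (hcont.intervalIntegrable (μ := MeasureTheory.volume))
    simp only [Complex.imCLM_apply] at this
    rw [← this]
    refine intervalIntegral.integral_congr fun s hs => ?_
    rw [Set.uIcc_of_le hd'] at hs
    have h1 := sin_mul_dirichlet_kernel K s
    have h2 := (hsin s hs).ne'
    show (1 : ℝ) + _ = Complex.im (_ * _)
    rw [Complex.im_ofReal_mul, mul_comm Complex.I, Complex.exp_ofReal_mul_I_im]
    generalize 1 + ∑ k ∈ Finset.Icc 1 K, 2 * cos (2 * π * k * s) = D at h1 ⊢
    rw [← h1]
    field_simp
  have hend : |d - 1 / 2 + sawtoothSum K d| ≤ 4 / (c * (2 * d)) := by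
    rw [← abs_neg, ← hintg, him]
    refine (Complex.abs_im_le_norm _).trans (hosc.trans ?_)
    have hd2 : 2 * d ≤ sin (π * d) := by
      have := mul_le_sin (x := π * d) (by positivity) (by nlinarith [pi_pos])
      refine le_trans (le_of_eq ?_) this
      field_simp
    have e1 : |(c * sin (π * d))⁻¹| ≤ 1 / (c * (2 * d)) := by
      rw [abs_of_pos (inv_pos.mpr (mul_pos hcpos (hsin d ⟨le_rfl, hd'⟩))), ← one_div]
      gcongr
    have e2 : |(c * sin (π * (1 / 2)))⁻¹| ≤ 1 / (c * (2 * d)) := by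
      rw [show π * (1 / 2) = π / 2 by ring, sin_pi_div_two, mul_one,
        abs_of_pos (inv_pos.mpr hcpos), ← one_div]
      gcongr
      nlinarith
    calc _ ≤ 2 * (1 / (c * (2 * d)) + 1 / (c * (2 * d))) := by gcongr
      _ = _ := by ring
  calc _ ≤ 4 / (c * (2 * d)) * ((K + 1) * d) := by gcongr
    _ = 2 * (K + 1) / c := by field_simp; ring
    _ ≤ 1 := by
      rw [div_le_one hcpos, hc]
      nlinarith [pi_gt_three, (Nat.cast_nonneg K : (0:ℝ) ≤ K)]

theorem abs_sawtooth_le {K : ℕ} {d : ℝ} (hd : 0 < d) (hd' : d ≤ 1 / 2) :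
    |d - 1 / 2 + sawtoothSum K d| ≤ 3 := by
  have h := abs_sawtooth_mul_le (K := K) hd hd'
  rcases le_or_gt 1 ((K + 1) * d) with h1 | h1
  · nlinarith [abs_nonneg (d - 1 / 2 + sawtoothSum K d)]
  · have h2 := abs_sawtoothSum_le K d
    rw [abs_of_pos hd] at h2
    rw [abs_le] at h2 ⊢
    constructor <;> nlinarith [h2.1, h2.2]

theorem abs_sawtoothError_eq (K : ℕ) (t : ℝ) :
    |sawtoothError K t| = |(|t - round t| - 1 / 2 + sawtoothSum K |t - round t|)| := by
  have hS : sawtoothSum K t = sawtoothSum K (Int.fract t) := by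
    conv_lhs => rw [← Int.fract_add_floor t]
    exact sawtoothSum_add_int K _ _
  rw [abs_sub_round_eq_min, sawtoothError, hS]
  rcases le_total (Int.fract t) (1 - Int.fract t) with h | h
  · rw [min_eq_left h]
  · rw [min_eq_right h]
    have : sawtoothSum K (1 - Int.fract t) = -sawtoothSum K (Int.fract t) := by
      rw [← sawtoothSum_neg, ← sawtoothSum_add_int K (-Int.fract t) 1]
      congr 1; push_cast; ring
    rw [this, ← abs_neg]
    congr 1; ring

theorem abs_sub_round_pos {t : ℝ} (ht : Int.fract t ≠ 0) : 0 < |t - round t| := by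
  rw [abs_sub_round_eq_min]
  exact lt_min (lt_of_le_of_ne (Int.fract_nonneg t) ht.symm)
    (by linarith [Int.fract_lt_one t])

theorem abs_sawtoothError_le (K : ℕ) (t : ℝ) : |sawtoothError K t| ≤ 3 := by
  by_cases ht : Int.fract t = 0
  · have : sawtoothSum K t = 0 := by
      have h := sawtoothSum_add_int K 0 ⌊t⌋
      rw [zero_add, ← Int.self_sub_fract t, ht, sub_zero] at h
      rw [h]; simp [sawtoothSum]
    rw [sawtoothError, this, ht]; norm_num [abs_of_nonneg]
  · rw [abs_sawtoothError_eq K t]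
    exact abs_sawtooth_le (abs_sub_round_pos ht) (abs_sub_round t)

theorem abs_sawtoothError_mul_le (K : ℕ) (t : ℝ) :
    |sawtoothError K t| * ((K + 1) * |t - round t|) ≤ 1 := by
  by_cases ht : Int.fract t = 0
  · rw [abs_sub_round_eq_min, ht]; simp
  · rw [abs_sawtoothError_eq K t]
    exact abs_sawtooth_mul_le (abs_sub_round_pos ht) (abs_sub_round t)

theorem measurable_sawtoothError (K : ℕ) : Measurable (sawtoothError K) := by
  have h : Continuous (sawtoothSum K) := by unfold sawtoothSum; fun_prop
  exact (measurable_fract.sub_const _).add h.measurable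

theorem intervalIntegrable_sawtoothError (K : ℕ) (a b : ℝ) :
    IntervalIntegrable (sawtoothError K) MeasureTheory.volume a b := by
  refine (intervalIntegrable_const (c := (3 : ℝ))).mono_fun
    (measurable_sawtoothError K).aestronglyMeasurable (Filter.Eventually.of_forall fun t => ?_)
  simpa using abs_sawtoothError_le K t

theorem sawtoothError_periodic (K : ℕ) : Function.Periodic (sawtoothError K) 1 := by
  intro t
  have h := sawtoothSum_add_int K t 1
  rw [Int.cast_one] at h
  rw [sawtoothError, h, Int.fract_add_one, sawtoothError]

theorem integral_abs_sawtoothError_unit_le (K : ℕ) :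
    ∫ t in (0 : ℝ)..1, |sawtoothError K t| ≤ 8 / √(K + 1) := by
  have hK : (0 : ℝ) < K + 1 := by positivity
  have hpt : ∀ t ∈ Set.Ioo (0 : ℝ) 1, |sawtoothError K t| ≤
      2 / √(K + 1) * (t ^ (-(1 / 2) : ℝ) + (1 - t) ^ (-(1 / 2) : ℝ)) := by
    intro t ht
    have h1 := abs_sawtoothError_le K t
    have h2 := abs_sawtoothError_mul_le K t
    have hfr : Int.fract t = t := Int.fract_eq_self.mpr ⟨ht.1.le, ht.2⟩
    rw [abs_sub_round_eq_min, hfr] at h2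
    have key : ∀ m : ℝ, 0 < m → |sawtoothError K t| * ((K + 1) * m) ≤ 1 →
        |sawtoothError K t| ≤ 2 / √(K + 1) * m ^ (-(1 / 2) : ℝ) := by
      intro m hm h
      rw [rpow_neg hm.le, ← sqrt_eq_rpow, ← div_eq_mul_inv, div_div,
        ← sqrt_mul hK.le, le_div_iff₀ (sqrt_pos.mpr (by positivity))]
      refine abs_le_of_sq_le_sq' ?_ (by norm_num) |>.2
      rw [mul_pow, sq_sqrt (by positivity)]
      nlinarith [abs_nonneg (sawtoothError K t)]
    have p1 : 0 ≤ t ^ (-(1 / 2) : ℝ) := rpow_nonneg ht.1.le _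
    have p2 : 0 ≤ (1 - t) ^ (-(1 / 2) : ℝ) := rpow_nonneg (by linarith [ht.2]) _
    rcases le_total t (1 - t) with h | h
    · rw [min_eq_left h] at h2
      refine (key t ht.1 h2).trans ?_
      gcongr; linarith
    · rw [min_eq_right h] at h2
      refine (key (1 - t) (by linarith [ht.2]) h2).trans ?_
      gcongr; linarith
  have i1 : IntervalIntegrable (fun t : ℝ => t ^ (-(1 / 2) : ℝ)) MeasureTheory.volume 0 1 :=
    intervalIntegral.intervalIntegrable_rpow' (by norm_num)
  have i2 : IntervalIntegrable (fun t : ℝ => (1 - t) ^ (-(1 / 2) : ℝ))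
      MeasureTheory.volume 0 1 := by
    have := (i1.comp_sub_left 1).symm
    simpa using this
  have v1 : ∫ t in (0 : ℝ)..1, t ^ (-(1 / 2) : ℝ) = 2 := by
    rw [integral_rpow (by norm_num)]; norm_num
  have v2 : ∫ t in (0 : ℝ)..1, (1 - t) ^ (-(1 / 2) : ℝ) = 2 := by
    rw [intervalIntegral.integral_comp_sub_left (fun t => t ^ (-(1 / 2) : ℝ)) 1]
    simpa using v1
  calc _ ≤ ∫ t in (0 : ℝ)..1,
        2 / √(K + 1) * (t ^ (-(1 / 2) : ℝ) + (1 - t) ^ (-(1 / 2) : ℝ)) :=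
        intervalIntegral.integral_mono_on_of_le_Ioo zero_le_one
          (intervalIntegrable_sawtoothError K 0 1).abs ((i1.add i2).const_mul _) hpt
    _ = _ := by
      rw [intervalIntegral.integral_const_mul, intervalIntegral.integral_add i1 i2, v1, v2]
      ring

theorem integral_abs_sawtoothError_le (K : ℕ) {A B : ℝ} (hA : 0 ≤ A) (hAB : A ≤ B) :
    ∫ t in A..B, |sawtoothError K t| ≤ (B + 1) * (8 / √(K + 1)) := by
  have hintg : ∀ a b, IntervalIntegrable (fun t => |sawtoothError K t|)
    MeasureTheory.volume a b := fun a b => (intervalIntegrable_sawtoothError K a b).abs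
  have hper : Function.Periodic (fun t => |sawtoothError K t|) 1 := fun t => by
    simp only [sawtoothError_periodic K t]
  have h1 : ∫ t in A..B, |sawtoothError K t| ≤ ∫ t in (0 : ℝ)..(⌈B⌉₊ : ℝ), |sawtoothError K t| :=
    intervalIntegral.integral_mono_interval hA hAB (Nat.le_ceil B)
      (Filter.Eventually.of_forall fun t => abs_nonneg _) (hintg _ _)
  have h2 : ∫ t in (0 : ℝ)..(⌈B⌉₊ : ℝ), |sawtoothError K t| =
      ⌈B⌉₊ * ∫ t in (0 : ℝ)..1, |sawtoothError K t| := by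
    have h := hper.intervalIntegral_add_zsmul_eq ⌈B⌉₊ 0 hintg
    simpa using h
  rw [h2] at h1
  refine h1.trans ?_
  have h3 : (⌈B⌉₊ : ℝ) ≤ B + 1 := (Nat.ceil_lt_add_one (hA.trans hAB)).le
  exact mul_le_mul h3 (integral_abs_sawtoothError_unit_le K)
    (intervalIntegral.integral_nonneg zero_le_one fun _ _ => abs_nonneg _)
    (by linarith)

/-- Euler–Maclaurin summation, with the sawtooth function split into its `K`-th Fourier partial
sum and the truncation error. -/
theorem sum_eq_integral_dirichlet_kernel (K : ℕ) {A B : ℝ} (hA : 0 ≤ A) (hAB : A ≤ B)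
    {F F' : ℝ → ℂ} (hF : ∀ t ∈ Set.Icc A B, HasDerivAt F (F' t) t)
    (hF' : ContinuousOn F' (Set.Icc A B)) :
    ∑ n ∈ Finset.Ioc ⌊A⌋₊ ⌊B⌋₊, F n =
      (∫ t in A..B, F t * ((1 + ∑ k ∈ Finset.Icc 1 K, 2 * cos (2 * π * k * t) : ℝ) : ℂ))
        - F B * sawtoothError K B + F A * sawtoothError K A
        + ∫ t in A..B, F' t * sawtoothError K t := by
  have hu : Set.uIcc A B = Set.Icc A B := Set.uIcc_of_le hAB
  have hder : ∀ t ∈ Set.Icc A B, deriv F t = F' t := fun t ht => (hF t ht).deriv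
  have habel := sum_mul_eq_sub_sub_integral_mul (fun _ => (1 : ℂ)) hA hAB
    (fun t ht => (hF t ht).differentiableAt)
    ((hF'.congr hder).integrableOn_Icc)
  simp only [mul_one, Finset.sum_const, Nat.card_Icc, tsub_zero, nsmul_eq_mul] at habel
  set G : ℝ → ℝ := fun t => t + 1 / 2 + sawtoothSum K t with hG
  have hfl : ∀ t : ℝ, 0 ≤ t → ((⌊t⌋₊ + 1 : ℕ) : ℂ) = (G t : ℂ) - (sawtoothError K t : ℂ) := by
    intro t ht
    have h : ((⌊t⌋₊ + 1 : ℕ) : ℝ) = G t - sawtoothError K t := by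
      have h1 : (⌊t⌋₊ : ℝ) = ⌊t⌋ := by
        exact natCast_floor_eq_intCast_floor ht
      push_cast
      rw [h1, ← Int.self_sub_fract, hG, sawtoothError]
      ring
    exact_mod_cast congrArg (fun r : ℝ => (r : ℂ)) h
  have hGd : ∀ t, HasDerivAt G (1 + ∑ k ∈ Finset.Icc 1 K, 2 * cos (2 * π * k * t)) t := fun t =>
    ((hasDerivAt_id t).add_const _).add (hasDerivAt_sawtoothSum K t)
  have hGc : Continuous G := continuous_iff_continuousAt.mpr fun t => (hGd t).continuousAt
  have hparts := intervalIntegral.integral_mul_deriv_eq_deriv_mul (a := A) (b := B)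
    (fun t ht => hF t (hu ▸ ht)) (fun t _ => (hGd t).ofReal_comp)
    (ContinuousOn.intervalIntegrable (by rwa [hu]))
    (Continuous.intervalIntegrable (by fun_prop) _ _)
  have hi1 : IntervalIntegrable (fun t => F' t * (G t : ℂ)) MeasureTheory.volume A B := by
    refine ContinuousOn.intervalIntegrable ?_
    rw [hu]
    exact hF'.mul (by fun_prop)
  have hi2 : IntervalIntegrable (fun t => F' t * (sawtoothError K t : ℂ))
      MeasureTheory.volume A B := by
    have h := intervalIntegrable_sawtoothError K A B
    have h' : IntervalIntegrable (fun t => (sawtoothError K t : ℂ))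
        MeasureTheory.volume A B := ⟨h.1.ofReal, h.2.ofReal⟩
    exact h'.continuousOn_mul (by rwa [hu])
  have hmain : ∫ t in Set.Ioc A B, deriv F t * ((⌊t⌋₊ + 1 : ℕ) : ℂ) =
      (∫ t in A..B, F' t * (G t : ℂ)) - ∫ t in A..B, F' t * (sawtoothError K t : ℂ) := by
    rw [← intervalIntegral.integral_of_le hAB, ← intervalIntegral.integral_sub hi1 hi2]
    refine intervalIntegral.integral_congr fun t ht => ?_
    rw [hu] at ht
    show deriv F t * ((⌊t⌋₊ + 1 : ℕ) : ℂ) = F' t * (G t : ℂ) - F' t * (sawtoothError K t : ℂ)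
    rw [hder t ht, hfl t (hA.trans ht.1)]
    ring
  rw [habel, hmain, hfl B (hA.trans hAB), hfl A hA, hparts]
  ring

theorem norm_sum_sub_integral_dirichlet_kernel_le (K : ℕ) {A B M : ℝ} (hA : 0 ≤ A) (hAB : A ≤ B)
    {F F' : ℝ → ℂ} (hF : ∀ t ∈ Set.Icc A B, HasDerivAt F (F' t) t)
    (hF' : ContinuousOn F' (Set.Icc A B)) (hF1 : ∀ t ∈ Set.Icc A B, ‖F t‖ ≤ 1)
    (hM : ∀ t ∈ Set.Icc A B, ‖F' t‖ ≤ M) :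
    ‖∑ n ∈ Finset.Ioc ⌊A⌋₊ ⌊B⌋₊, F n -
      ∫ t in A..B, F t * ((1 + ∑ k ∈ Finset.Icc 1 K, 2 * cos (2 * π * k * t) : ℝ) : ℂ)‖
      ≤ 6 + M * ((B + 1) * (8 / √(K + 1))) := by
  have hM0 : 0 ≤ M := (norm_nonneg _).trans (hM A ⟨le_rfl, hAB⟩)
  have hb : ∀ t ∈ Set.Icc A B, ‖F t * (sawtoothError K t : ℂ)‖ ≤ 3 := fun t ht => by
    rw [norm_mul, Complex.norm_real, Real.norm_eq_abs]
    calc _ ≤ 1 * 3 := mul_le_mul (hF1 t ht) (abs_sawtoothError_le K t) (abs_nonneg _) zero_le_one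
      _ = 3 := one_mul 3
  have hi : ‖∫ t in A..B, F' t * sawtoothError K t‖ ≤ M * ((B + 1) * (8 / √(K + 1))) := by
    have h1 : ‖∫ t in A..B, F' t * sawtoothError K t‖ ≤
        ∫ t in A..B, M * |sawtoothError K t| := by
      refine intervalIntegral.norm_integral_le_of_norm_le hAB
        (Filter.Eventually.of_forall fun t ht => ?_)
        ((intervalIntegrable_sawtoothError K A B).abs.const_mul M)
      rw [norm_mul, Complex.norm_real, Real.norm_eq_abs]
      exact mul_le_mul_of_nonneg_right (hM t ⟨ht.1.le, ht.2⟩) (abs_nonneg _)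
    refine h1.trans ?_
    rw [intervalIntegral.integral_const_mul]
    exact mul_le_mul_of_nonneg_left (integral_abs_sawtoothError_le K hA hAB) hM0
  rw [sum_eq_integral_dirichlet_kernel K hA hAB hF hF']
  have e : ∀ a b c d : ℂ, a - b + c + d - a = c - b + d := fun a b c d => by ring
  rw [e]
  refine (norm_add_le _ _).trans (add_le_add ((norm_sub_le _ _).trans ?_) hi)
  linarith [hb A ⟨le_rfl, hAB⟩, hb B ⟨hAB, le_rfl⟩]

/-- The incomplete Fresnel integral. -/
noncomputable def fresnel (L P : ℝ) : ℂ :=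
  ∫ p in (0 : ℝ)..P, Complex.exp (Complex.I * (L * p ^ 2 : ℝ))

/-- The limit of `fresnel L P` as `P → ∞`. -/
noncomputable def fresnelLimit (L : ℝ) : ℂ :=
  (√(π / L) / 2 : ℝ) * Complex.exp (Complex.I * (π / 4 : ℝ))

theorem norm_integral_damped_fresnel_le {L δ P R : ℝ} (hL : 0 < L) (hδ : 0 ≤ δ) (hP : 0 < P)
    (hPR : P ≤ R) :
    ‖∫ p in P..R, Complex.exp (-(δ - L * Complex.I) * (p : ℂ) ^ 2)‖ ≤ 2 / (L * P) := by
  have hosc := norm_integral_oscillatory_le hPR (φ := fun p => L * p ^ 2)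
    (φ' := fun p => L * (2 * p))
    (g := fun p => exp (-δ * p ^ 2) * (2 * L * p)⁻¹)
    (g' := fun p => exp (-δ * p ^ 2) * (-δ * (2 * p)) * (2 * L * p)⁻¹ +
      exp (-δ * p ^ 2) * (-(2 * L) / (2 * L * p) ^ 2))
    (fun p _ => by simpa using (hasDerivAt_pow 2 p).const_mul L)
    (fun p hp => by
      have hp0 : 0 < p := hP.trans_le hp.1
      have h1 := ((hasDerivAt_pow 2 p).const_mul (-δ)).exp
      have h2 := ((hasDerivAt_id p).const_mul (2 * L)).fun_inv (by simp [hL.ne', hp0.ne'])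
      simpa using h1.fun_mul h2)
    (by fun_prop)
    (by
      have : ∀ p ∈ Set.Icc P R, 2 * L * p ≠ 0 := fun p hp => by
        have hp0 : 0 < p := hP.trans_le hp.1
        positivity
      have h2 : ∀ p ∈ Set.Icc P R, (2 * L * p) ^ 2 ≠ 0 := fun p hp => pow_ne_zero 2 (this p hp)
      fun_prop (disch := assumption))
    (Or.inr fun p hp => by
      have hp0 : 0 < p := hP.trans_le hp.1
      have e1 : 0 ≤ exp (-δ * p ^ 2) * (δ * (2 * p)) * (2 * L * p)⁻¹ := by positivity
      have e2 : 0 ≤ exp (-δ * p ^ 2) * ((2 * L) / (2 * L * p) ^ 2) := by positivity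
      rw [neg_div]
      linarith)
  have hcongr : ∫ p in P..R, Complex.exp (-(δ - L * Complex.I) * (p : ℂ) ^ 2) =
      ∫ p in P..R, ((exp (-δ * p ^ 2) * (2 * L * p)⁻¹ * (L * (2 * p)) : ℝ) : ℂ) *
        Complex.exp (Complex.I * (L * p ^ 2 : ℝ)) := by
    refine intervalIntegral.integral_congr fun p hp => ?_
    rw [Set.uIcc_of_le hPR] at hp
    have hp0 : 0 < p := hP.trans_le hp.1
    have e : exp (-δ * p ^ 2) * (2 * L * p)⁻¹ * (L * (2 * p)) = exp (-δ * p ^ 2) := by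
      field_simp
    rw [e, Complex.ofReal_exp, ← Complex.exp_add]
    congr 1; push_cast; ring
  rw [hcongr]
  refine hosc.trans ?_
  have hg : ∀ p, P ≤ p → |exp (-δ * p ^ 2) * (2 * L * p)⁻¹| ≤ (2 * L * P)⁻¹ := fun p hp => by
    have hp0 : 0 < p := hP.trans_le hp
    rw [abs_of_pos (by positivity)]
    calc _ ≤ 1 * (2 * L * P)⁻¹ := by
          gcongr
          exact exp_le_one_iff.mpr (by have : 0 ≤ δ * p ^ 2 := by positivity
                                       linarith)
      _ = _ := one_mul _
  calc _ ≤ 2 * ((2 * L * P)⁻¹ + (2 * L * P)⁻¹) := by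
        gcongr
        · exact hg P le_rfl
        · exact hg R hPR
    _ = _ := by field_simp; ring

theorem norm_damped_fresnel_sub_le {L δ P : ℝ} (hL : 0 < L) (hδ : 0 < δ) (hP : 0 < P) :
    ‖(∫ p in (0 : ℝ)..P, Complex.exp (-(δ - L * Complex.I) * (p : ℂ) ^ 2)) -
      (π / (δ - L * Complex.I)) ^ (1 / 2 : ℂ) / 2‖ ≤ 2 / (L * P) := by
  have hre : 0 < ((δ : ℂ) - L * Complex.I).re := by simpa using hδ
  have hintg := integrable_cexp_neg_mul_sq hre
  have hcont : Continuous fun p : ℝ => Complex.exp (-(δ - L * Complex.I) * (p : ℂ) ^ 2) := by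
    fun_prop
  have hlim := MeasureTheory.intervalIntegral_tendsto_integral_Ioi 0
    (hintg.integrableOn (s := Set.Ioi 0)) Filter.tendsto_id
  rw [integral_gaussian_complex_Ioi hre] at hlim
  have hlim2 := (hlim.const_sub
    (∫ p in (0 : ℝ)..P, Complex.exp (-(δ - L * Complex.I) * (p : ℂ) ^ 2))).norm
  refine le_of_tendsto hlim2 ?_
  filter_upwards [Filter.eventually_ge_atTop P] with R hR
  rw [intervalIntegral.integral_interval_sub_left (hcont.intervalIntegrable _ _)
    (hcont.intervalIntegrable _ _), intervalIntegral.integral_symm, norm_neg]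
  exact norm_integral_damped_fresnel_le hL hδ.le hP hR

theorem cpow_half_eq_fresnelLimit {L : ℝ} (hL : 0 < L) :
    ((π : ℂ) / (((0 : ℝ) : ℂ) - L * Complex.I)) ^ (1 / 2 : ℂ) / 2 = fresnelLimit L := by
  have e : (π : ℂ) / (((0 : ℝ) : ℂ) - L * Complex.I) = ((π / L : ℝ) : ℂ) * Complex.I := by
    have : (L : ℂ) ≠ 0 := by exact_mod_cast hL.ne'
    rw [div_eq_iff (by simp [this])]
    push_cast
    rw [show (π / L : ℂ) * Complex.I * (0 - L * Complex.I) = -(π * (L / L)) * Complex.I ^ 2 by ring,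
      Complex.I_sq, div_self this]
    ring
  have hr : 0 < π / L := by positivity
  rw [e, Complex.cpow_def_of_ne_zero (mul_ne_zero (by exact_mod_cast hr.ne') Complex.I_ne_zero),
    Complex.log_ofReal_mul hr Complex.I_ne_zero, Complex.log_I, fresnelLimit, sqrt_eq_rpow,
    rpow_def_of_pos hr, add_mul, Complex.exp_add]
  push_cast
  ring_nf

theorem norm_fresnel_sub_le_of_pos {L P : ℝ} (hL : 0 < L) (hP : 0 < P) :
    ‖fresnel L P - fresnelLimit L‖ ≤ 2 / (L * P) := by
  have h1 : Continuous fun δ : ℝ =>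
      ∫ p in (0 : ℝ)..P, Complex.exp (-(δ - L * Complex.I) * (p : ℂ) ^ 2) := by
    apply intervalIntegral.continuous_parametric_intervalIntegral_of_continuous'
    fun_prop
  have h2 : ContinuousAt (fun δ : ℝ => ((π : ℂ) / (δ - L * Complex.I)) ^ (1 / 2 : ℂ) / 2) 0 := by
    have hne : ((0 : ℝ) : ℂ) - L * Complex.I ≠ 0 := by
      simp [hL.ne']
    refine ContinuousAt.div_const (ContinuousAt.cpow ?_ continuousAt_const ?_) _
    · exact continuousAt_const.div (by fun_prop) hne
    · right
      simp [Complex.div_im, hL.ne', Complex.normSq]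
  have h3 := ((h1.continuousAt (x := 0)).sub h2).norm
  have h4 : fresnel L P = ∫ p in (0 : ℝ)..P,
      Complex.exp (-(((0 : ℝ) : ℂ) - L * Complex.I) * (p : ℂ) ^ 2) := by
    unfold fresnel
    congr 1; ext p; congr 1; push_cast; ring
  rw [h4, ← cpow_half_eq_fresnelLimit hL]
  refine le_of_tendsto (x := nhdsWithin (0 : ℝ) (Set.Ioi 0))
    (h3.tendsto.mono_left nhdsWithin_le_nhds) ?_
  filter_upwards [self_mem_nhdsWithin] with δ hδ
  exact norm_damped_fresnel_sub_le hL hδ hP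

theorem fresnel_neg (L P : ℝ) : fresnel L (-P) = -fresnel L P := by
  unfold fresnel
  have := intervalIntegral.integral_comp_neg (a := 0) (b := P)
    (fun p : ℝ => Complex.exp (Complex.I * (L * p ^ 2 : ℝ)))
  simp only [neg_sq, neg_zero] at this
  rw [intervalIntegral.integral_symm, this]

theorem norm_fresnel_le (L P : ℝ) : ‖fresnel L P‖ ≤ |P| := by
  have := intervalIntegral.norm_integral_le_of_norm_le_const (a := 0) (b := P) (C := 1)
    (f := fun p : ℝ => Complex.exp (Complex.I * (L * p ^ 2 : ℝ)))
    (fun p _ => by rw [mul_comm, Complex.norm_exp_ofReal_mul_I])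
  simpa [fresnel] using this

theorem norm_fresnelLimit {L : ℝ} : ‖fresnelLimit L‖ = √(π / L) / 2 := by
  rw [fresnelLimit, norm_mul, mul_comm Complex.I, Complex.norm_exp_ofReal_mul_I, mul_one,
    Complex.norm_real, Real.norm_eq_abs, abs_of_nonneg (by positivity)]

theorem norm_fresnel_sub_sign_le {L : ℝ} (hL : 0 < L) (P : ℝ) :
    ‖fresnel L P - Real.sign P * fresnelLimit L‖ ≤ 2 / (L * |P|) := by
  rcases lt_trichotomy P 0 with h | h | h
  · have := norm_fresnel_sub_le_of_pos hL (neg_pos.mpr h)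
    rw [fresnel_neg, ← norm_neg] at this
    rw [Real.sign_of_neg h, abs_of_neg h]
    rwa [show fresnel L P - ((-1 : ℝ) : ℂ) * fresnelLimit L =
      -(-fresnel L P - fresnelLimit L) by push_cast; ring]
  · subst h
    simp [fresnel]
  · rw [Real.sign_of_pos h, abs_of_pos h]
    simpa using norm_fresnel_sub_le_of_pos hL h

theorem norm_fresnel_sub_sign_le_inv_sqrt {L : ℝ} (hL : 0 < L) (P : ℝ) :
    ‖fresnel L P - Real.sign P * fresnelLimit L‖ ≤ 2 / √L := by
  have hs : 0 < √L := sqrt_pos.mpr hL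
  rcases le_or_gt (1 / √L) |P| with h | h
  · refine (norm_fresnel_sub_sign_le hL P).trans ?_
    gcongr
    rw [div_le_iff₀ hs] at h
    have := mul_self_sqrt hL.le
    nlinarith [abs_nonneg P]
  · have h1 := norm_fresnel_le L P
    have h2 : ‖(Real.sign P : ℂ) * fresnelLimit L‖ ≤ 1 / √L := by
      rw [norm_mul, Complex.norm_real, norm_fresnelLimit, sqrt_div pi_pos.le]
      have hsg : ‖Real.sign P‖ ≤ 1 := by
        rcases Real.sign_apply_eq P with h | h | h <;> simp [h]
      have hpi : √π ≤ 2 := by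
        rw [sqrt_le_left (by norm_num)]
        linarith [pi_le_four]
      calc _ ≤ 1 * (2 / √L / 2) := by gcongr
        _ = _ := by ring
    calc _ ≤ ‖fresnel L P‖ + ‖(Real.sign P : ℂ) * fresnelLimit L‖ := norm_sub_le _ _
      _ ≤ 1 / √L + 1 / √L := by linarith
      _ = _ := by ring

theorem norm_integral_sub_fresnel_le {L a b : ℝ} (hL : 0 < L) (ha : 0 < a) (hab : a ≤ b) :
    ‖(∫ v in a..b, Complex.exp (Complex.I * (L * (v ^ 2 + (v ^ 2)⁻¹) : ℝ)) * (2 * v : ℝ)) -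
      Complex.exp (Complex.I * (2 * L : ℝ)) * (fresnel L (b - b⁻¹) - fresnel L (a - a⁻¹))‖
      ≤ 4 / L := by
  have hu : Set.uIcc a b = Set.Icc a b := Set.uIcc_of_le hab
  have hpos : ∀ v ∈ Set.Icc a b, 0 < v := fun v hv => ha.trans_le hv.1
  have hne : ∀ v ∈ Set.Icc a b, v ≠ 0 := fun v hv => (hpos v hv).ne'
  have hne2 : ∀ v ∈ Set.Icc a b, v ^ 2 ≠ 0 := fun v hv => pow_ne_zero 2 (hne v hv)
  have hosc := norm_integral_oscillatory_le hab (φ := fun v => L * (v ^ 2 + (v ^ 2)⁻¹))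
    (φ' := fun v => L * (2 * v - 2 * v / (v ^ 2) ^ 2))
    (g := fun v => (2 * v ^ 3 + v ^ 2 + v) / (2 * L * (v ^ 3 + v ^ 2 + v + 1)))
    (g' := fun v => (v ^ 4 + 2 * v ^ 3 + 6 * v ^ 2 + 2 * v + 1) /
      (2 * L * (v ^ 3 + v ^ 2 + v + 1) ^ 2))
    (fun v hv => by
      have h1 : HasDerivAt (fun v : ℝ => v ^ 2) (2 * v) v := by simpa using hasDerivAt_pow 2 v
      refine ((h1.fun_add (h1.fun_inv (hne2 v hv))).const_mul L).congr_deriv ?_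
      ring)
    (fun v hv => by
      have hv0 := hpos v hv
      have h1 : HasDerivAt (fun v : ℝ => v) 1 v := hasDerivAt_id v
      have h2 : HasDerivAt (fun v : ℝ => v ^ 2) (2 * v) v := by simpa using hasDerivAt_pow 2 v
      have h3 : HasDerivAt (fun v : ℝ => v ^ 3) (3 * v ^ 2) v := by
        simpa using hasDerivAt_pow 3 v
      have hn := ((h3.const_mul 2).fun_add h2).fun_add h1
      have hd := (((h3.fun_add h2).fun_add h1).add_const 1).const_mul (2 * L)
      refine (hn.fun_div hd (by positivity)).congr_deriv ?_
      field_simp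
      ring)
    (by
      have h4 : ∀ v ∈ Set.Icc a b, (v ^ 2) ^ 2 ≠ 0 := fun v hv => pow_ne_zero 2 (hne2 v hv)
      fun_prop (disch := assumption))
    (by
      have : ∀ v ∈ Set.Icc a b, 2 * L * (v ^ 3 + v ^ 2 + v + 1) ^ 2 ≠ 0 := fun v hv => by
        have := hpos v hv
        positivity
      fun_prop (disch := assumption))
    (Or.inl fun v hv => by have := hpos v hv; positivity)
  have hg : ∀ v ∈ Set.Icc a b,
      |(2 * v ^ 3 + v ^ 2 + v) / (2 * L * (v ^ 3 + v ^ 2 + v + 1))| ≤ 1 / L := fun v hv => by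
    have := hpos v hv
    rw [abs_of_nonneg (by positivity), div_le_div_iff₀ (by positivity) hL]
    have : 0 ≤ L * (v ^ 2 + v + 2) := by positivity
    linarith
  have hc1 : ContinuousOn (fun v : ℝ => Complex.exp (Complex.I * (L * (v ^ 2 + (v ^ 2)⁻¹) : ℝ)))
      (Set.Icc a b) := by
    have : ContinuousOn (fun v : ℝ => L * (v ^ 2 + (v ^ 2)⁻¹)) (Set.Icc a b) := by
      fun_prop (disch := assumption)
    exact (continuousOn_const.mul (Complex.continuous_ofReal.comp_continuousOn this)).cexp
  have hc2 : ContinuousOn (fun v : ℝ => ((1 + (v ^ 2)⁻¹ : ℝ) : ℂ)) (Set.Icc a b) := by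
    refine Complex.continuous_ofReal.comp_continuousOn ?_
    fun_prop (disch := assumption)
  have hfr : ∫ v in a..b, Complex.exp (Complex.I * (L * (v ^ 2 + (v ^ 2)⁻¹) : ℝ)) *
      ((1 + (v ^ 2)⁻¹ : ℝ) : ℂ) =
      Complex.exp (Complex.I * (2 * L : ℝ)) * (fresnel L (b - b⁻¹) - fresnel L (a - a⁻¹)) := by
    have hcont : Continuous fun p : ℝ => Complex.exp (Complex.I * (L * p ^ 2 : ℝ)) := by fun_prop
    have h := intervalIntegral.integral_deriv_smul_comp (a := a) (b := b)
      (f := fun v : ℝ => v - v⁻¹) (f' := fun v => 1 + (v ^ 2)⁻¹)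
      (g := fun p : ℝ => Complex.exp (Complex.I * (L * p ^ 2 : ℝ)))
      (fun v hv => by
        simpa using (hasDerivAt_id v).fun_sub (hasDerivAt_inv (hne v (hu ▸ hv))))
      (by rw [hu]; fun_prop (disch := assumption)) hcont
    unfold fresnel
    rw [intervalIntegral.integral_interval_sub_left (hcont.intervalIntegrable _ _)
      (hcont.intervalIntegrable _ _), ← h, ← intervalIntegral.integral_const_mul]
    refine intervalIntegral.integral_congr fun v hv => ?_
    have hv0 := hne v (hu ▸ hv)
    simp only [Function.comp, Complex.real_smul]
    rw [show L * (v ^ 2 + (v ^ 2)⁻¹) = 2 * L + L * (v - v⁻¹) ^ 2 by field_simp; ring,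
      Complex.ofReal_add, mul_add, Complex.exp_add]
    ring
  have hsplit : (∫ v in a..b, Complex.exp (Complex.I * (L * (v ^ 2 + (v ^ 2)⁻¹) : ℝ)) *
      (2 * v : ℝ)) - ∫ v in a..b, Complex.exp (Complex.I * (L * (v ^ 2 + (v ^ 2)⁻¹) : ℝ)) *
        ((1 + (v ^ 2)⁻¹ : ℝ) : ℂ) =
      ∫ v in a..b, (((2 * v ^ 3 + v ^ 2 + v) / (2 * L * (v ^ 3 + v ^ 2 + v + 1)) *
        (L * (2 * v - 2 * v / (v ^ 2) ^ 2)) : ℝ) : ℂ) *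
        Complex.exp (Complex.I * (L * (v ^ 2 + (v ^ 2)⁻¹) : ℝ)) := by
    rw [← intervalIntegral.integral_sub]
    · refine intervalIntegral.integral_congr fun v hv => ?_
      have hv0 := hpos v (hu ▸ hv)
      have e : (2 * v ^ 3 + v ^ 2 + v) / (2 * L * (v ^ 3 + v ^ 2 + v + 1)) *
        (L * (2 * v - 2 * v / (v ^ 2) ^ 2)) = 2 * v - (1 + (v ^ 2)⁻¹) := by
        field_simp
        ring
      simp only [e]
      push_cast
      ring
    · exact ContinuousOn.intervalIntegrable (by rw [hu]; exact hc1.mul (by fun_prop))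
    · exact ContinuousOn.intervalIntegrable (by rw [hu]; exact hc1.mul hc2)
  rw [← hfr, hsplit]
  refine hosc.trans ?_
  calc _ ≤ 2 * (1 / L + 1 / L) := by
        gcongr
        · exact hg a ⟨le_rfl, hab⟩
        · exact hg b ⟨hab, le_rfl⟩
    _ = _ := by ring

/-- An oscillatory integral whose phase is stationary at `c`, compared with Fresnel integrals. -/
theorem norm_integral_stationary_sub_fresnel_le {L c A B : ℝ} (hL : 0 < L) (hc : 0 < c)
    (hA : 0 < A) (hAB : A ≤ B) :
    ‖(∫ t in A..B, Complex.exp (Complex.I * (L * (t / c + c / t) : ℝ))) -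
      c * Complex.exp (Complex.I * (2 * L : ℝ)) *
        (fresnel L (√(B / c) - (√(B / c))⁻¹) - fresnel L (√(A / c) - (√(A / c))⁻¹))‖
      ≤ 4 * c / L := by
  set a := √(A / c) with ha
  set b := √(B / c) with hb
  have ha0 : 0 < a := sqrt_pos.mpr (by positivity)
  have hab : a ≤ b := sqrt_le_sqrt (by gcongr)
  have hca : c * a ^ 2 = A := by rw [ha, sq_sqrt (by positivity)]; field_simp
  have hcb : c * b ^ 2 = B := by
    have : 0 < B := hA.trans_le hAB
    rw [hb, sq_sqrt (by positivity)]; field_simp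
  have hu : Set.uIcc a b = Set.Icc a b := Set.uIcc_of_le hab
  have h := intervalIntegral.integral_deriv_smul_comp' (a := a) (b := b)
    (f := fun v : ℝ => c * v ^ 2) (f' := fun v => c * (2 * v))
    (g := fun t : ℝ => Complex.exp (Complex.I * (L * (t / c + c / t) : ℝ)))
    (fun v _ => by simpa using (hasDerivAt_pow 2 v).const_mul c) (by fun_prop)
    (by
      have : ContinuousOn (fun t : ℝ => L * (t / c + c / t))
          ((fun v : ℝ => c * v ^ 2) '' Set.uIcc a b) := by
        have : ∀ t ∈ (fun v : ℝ => c * v ^ 2) '' Set.uIcc a b, t ≠ 0 := by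
          rintro _ ⟨v, hv, rfl⟩
          rw [hu] at hv
          have := ha0.trans_le hv.1
          positivity
        fun_prop (disch := assumption)
      exact (continuousOn_const.mul (Complex.continuous_ofReal.comp_continuousOn this)).cexp)
  simp only [hca, hcb] at h
  have h2 : ∫ t in A..B, Complex.exp (Complex.I * (L * (t / c + c / t) : ℝ)) =
      c * ∫ v in a..b, Complex.exp (Complex.I * (L * (v ^ 2 + (v ^ 2)⁻¹) : ℝ)) *
        (2 * v : ℝ) := by
    rw [← h, ← intervalIntegral.integral_const_mul]
    refine intervalIntegral.integral_congr fun v hv => ?_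
    simp only [Function.comp, Complex.real_smul]
    rw [show L * (c * v ^ 2 / c + c / (c * v ^ 2)) = L * (v ^ 2 + (v ^ 2)⁻¹) by field_simp]
    push_cast
    ring
  rw [h2, mul_assoc, ← mul_sub, norm_mul, Complex.norm_real, Real.norm_eq_abs, abs_of_pos hc]
  calc _ ≤ c * (4 / L) := by
        gcongr
        exact norm_integral_sub_fresnel_le hL ha0 hab
    _ = _ := by ring

theorem norm_integral_nonstationary_le {h k x A : ℝ} (hh : 0 < h) (hk : 0 ≤ k) (hA : 0 < A)
    (hAx : A ≤ x) :
    ‖∫ t in A..x, Complex.exp (Complex.I * (2 * π * (h * x ^ 2 / t - k * t) : ℝ))‖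
      ≤ 1 / (h + k) := by
  have hx : 0 < x := hA.trans_le hAx
  have hpos : ∀ t ∈ Set.Icc A x, 0 < t := fun t ht => hA.trans_le ht.1
  have hne : ∀ t ∈ Set.Icc A x, t ≠ 0 := fun t ht => (hpos t ht).ne'
  have hne2 : ∀ t ∈ Set.Icc A x, t ^ 2 ≠ 0 := fun t ht => pow_ne_zero 2 (hne t ht)
  have hosc := norm_integral_oscillatory_le hAx
    (φ := fun t => 2 * π * (h * x ^ 2 / t - k * t))
    (φ' := fun t => 2 * π * (h * x ^ 2 * (-(t ^ 2)⁻¹) - k))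
    (g := fun t => -(t ^ 2 / (2 * π * (h * x ^ 2 + k * t ^ 2))))
    (g' := fun t => -(4 * π * t * (h * x ^ 2) / (2 * π * (h * x ^ 2 + k * t ^ 2)) ^ 2))
    (fun t ht => by
      have h1 := ((hasDerivAt_inv (hne t ht)).const_mul (h * x ^ 2)).fun_sub
        ((hasDerivAt_id t).const_mul k)
      simpa [div_eq_mul_inv] using h1.const_mul (2 * π))
    (fun t ht => by
      have ht0 := hpos t ht
      have h2 : HasDerivAt (fun t : ℝ => t ^ 2) (2 * t) t := by simpa using hasDerivAt_pow 2 t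
      have hd := ((h2.const_mul k).const_add (h * x ^ 2)).const_mul (2 * π)
      refine (h2.fun_div hd (by positivity)).fun_neg.congr_deriv ?_
      congr 2
      ring)
    (by fun_prop (disch := assumption))
    (by
      have : ∀ t ∈ Set.Icc A x, (2 * π * (h * x ^ 2 + k * t ^ 2)) ^ 2 ≠ 0 := fun t ht => by
        positivity
      fun_prop (disch := assumption))
    (Or.inr fun t ht => by
      have := hpos t ht
      rw [neg_nonpos]
      positivity)
  have hcongr : ∫ t in A..x, Complex.exp (Complex.I * (2 * π * (h * x ^ 2 / t - k * t) : ℝ)) =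
      ∫ t in A..x, ((-(t ^ 2 / (2 * π * (h * x ^ 2 + k * t ^ 2))) *
        (2 * π * (h * x ^ 2 * (-(t ^ 2)⁻¹) - k)) : ℝ) : ℂ) *
        Complex.exp (Complex.I * (2 * π * (h * x ^ 2 / t - k * t) : ℝ)) := by
    refine intervalIntegral.integral_congr fun t ht => ?_
    rw [Set.uIcc_of_le hAx] at ht
    have ht0 := hpos t ht
    have e : -(t ^ 2 / (2 * π * (h * x ^ 2 + k * t ^ 2))) *
        (2 * π * (h * x ^ 2 * (-(t ^ 2)⁻¹) - k)) = 1 := by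
      field_simp
      ring
    simp only [e, Complex.ofReal_one, one_mul]
  have hg : ∀ t ∈ Set.Icc A x,
      |-(t ^ 2 / (2 * π * (h * x ^ 2 + k * t ^ 2)))| ≤ 1 / (2 * π * (h + k)) := fun t ht => by
    have ht0 := hpos t ht
    rw [abs_neg, abs_of_nonneg (by positivity),
      div_le_div_iff₀ (by positivity) (by positivity)]
    have : t ^ 2 ≤ x ^ 2 := by gcongr; exact ht.2
    have : 2 * π * (h * t ^ 2) ≤ 2 * π * (h * x ^ 2) := by gcongr
    linarith
  rw [hcongr]
  refine hosc.trans ?_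
  calc _ ≤ 2 * (1 / (2 * π * (h + k)) + 1 / (2 * π * (h + k))) := by
        gcongr
        · exact hg A ⟨le_rfl, hAx⟩
        · exact hg x ⟨hAx, le_rfl⟩
    _ = 2 / π * (1 / (h + k)) := by field_simp; ring
    _ ≤ 1 * (1 / (h + k)) := by
        gcongr
        rw [div_le_one pi_pos]
        linarith [pi_gt_three]
    _ = _ := one_mul _

theorem one_div_abs_sqrt_sub_inv_le {U : ℝ} (hU : 0 < U) (hU1 : U ≠ 1) :
    1 / |√U - (√U)⁻¹| ≤ 2 * (1 + 1 / |U ^ 2 - 1|) := by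
  set v := √U with hv
  have hv0 : 0 < v := sqrt_pos.mpr hU
  have hvU : U = v ^ 2 := (sq_sqrt hU.le).symm
  have e : |v - v⁻¹| = |U - 1| / v := by
    rw [show v - v⁻¹ = (U - 1) / v by rw [hvU]; field_simp, abs_div, abs_of_pos hv0]
  have h1 : 0 < |U - 1| := abs_pos.mpr (sub_ne_zero.mpr hU1)
  rw [e, one_div_div, show U ^ 2 - 1 = (U - 1) * (U + 1) by ring, abs_mul,
    abs_of_pos (show 0 < U + 1 by linarith)]
  have e2 : 2 * (1 + 1 / (|U - 1| * (U + 1))) =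
      2 * (1 + |U - 1| * (U + 1)) / ((U + 1) * |U - 1|) := by field_simp; ring
  rw [e2, ← div_div]
  gcongr
  rw [le_div_iff₀ (by linarith)]
  rcases le_total 1 U with h | h
  · rw [abs_of_nonneg (by linarith)]
    have hv1 : 1 ≤ v := by nlinarith
    have : v * (U + 1) ≤ U * (2 * U) := by
      gcongr
      · nlinarith
      · linarith
    linarith
  · have hv1 : v ≤ 1 := by nlinarith
    nlinarith [mul_nonneg h1.le hU.le]

theorem sign_sqrt_sub_inv {U : ℝ} (hU : 0 < U) :
    Real.sign (√U - (√U)⁻¹) = Real.sign (U ^ 2 - 1) := by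
  set v := √U with hv
  have hvU : U = v ^ 2 := (sq_sqrt hU.le).symm
  have e : v - v⁻¹ = (v - 1) * ((v + 1) / v) := by field_simp; ring
  have e2 : U ^ 2 - 1 = (v - 1) * ((v + 1) * (v ^ 2 + 1)) := by rw [hvU]; ring
  rw [e, e2]
  rcases lt_trichotomy v 1 with h | h | h
  · rw [Real.sign_of_neg (mul_neg_of_neg_of_pos (by linarith) (by positivity)),
      Real.sign_of_neg (mul_neg_of_neg_of_pos (by linarith) (by positivity))]
  · simp [h]
  · rw [Real.sign_of_pos (mul_pos (by linarith) (by positivity)),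
      Real.sign_of_pos (mul_pos (by linarith) (by positivity))]

theorem sign_div_sub_one {a b : ℝ} (hb : 0 < b) : Real.sign (a / b - 1) = Real.sign (a - b) := by
  have e : a / b - 1 = (a - b) / b := by field_simp
  rw [e]
  rcases lt_trichotomy a b with h | h | h
  · rw [Real.sign_of_neg (div_neg_of_neg_of_pos (by linarith) hb),
      Real.sign_of_neg (by linarith)]
  · simp [h]
  · rw [Real.sign_of_pos (div_pos (by linarith) hb), Real.sign_of_pos (by linarith)]

/-- The summand of the Voronoï series, before taking imaginary parts. -/
noncomputable def voronoiTerm (x n : ℝ) : ℂ :=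
  (√x / (2 * √2) * n ^ (-(3 : ℝ) / 4) : ℝ) *
    Complex.exp (Complex.I * (4 * π * √n * x + π / 4 : ℝ))

theorem voronoiTerm_eq {x h k : ℝ} (hx : 0 < x) (hh : 0 < h) (hk : 0 < k) :
    voronoiTerm x (h * k) = (1 / h : ℝ) * ((x * √(h * k) / k : ℝ) *
      Complex.exp (Complex.I * (2 * (2 * π * x * √(h * k)) : ℝ)) *
        fresnelLimit (2 * π * x * √(h * k))) := by
  set s := √(h * k) with hs
  have hs0 : 0 < s := sqrt_pos.mpr (by positivity)
  have hs2 : s ^ 2 = h * k := sq_sqrt (by positivity)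
  have e1 : (h * k) ^ (-(3 : ℝ) / 4) = 1 / (s * √s) := by
    rw [← hs2, ← rpow_natCast, ← rpow_mul hs0.le, sqrt_eq_rpow]
    nth_rewrite 2 [← rpow_one s]
    rw [← rpow_add hs0, one_div, ← rpow_neg hs0.le]
    norm_num
  have e2 : √(π / (2 * π * x * s)) = 1 / (√2 * √x * √s) := by
    rw [show π / (2 * π * x * s) = 1 / (2 * x * s) by field_simp, sqrt_div zero_le_one, sqrt_one,
      sqrt_mul (by positivity), sqrt_mul (by positivity)]
  have e3 : √x / (2 * √2) * (1 / (s * √s)) =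
      1 / h * (x * s / k * (1 / (√2 * √x * √s) / 2)) := by
    have hx2 : √x ^ 2 = x := sq_sqrt hx.le
    field_simp
    rw [hx2, hs2]
    ring
  rw [voronoiTerm, fresnelLimit, ← hs, e1, e2, e3,
    show 4 * π * s * x + π / 4 = 2 * (2 * π * x * s) + π / 4 by ring, Complex.ofReal_add, mul_add,
    Complex.exp_add]
  push_cast
  ring

theorem one_div_mul_one_div_abs_sqrt_sub_inv_le {k q : ℝ} (hk : 0 < k) (hq : 0 < q) :
    1 / (π * k) * (1 / |√√(k / q) - (√√(k / q))⁻¹|) ≤ 2 / k + 1 / |k - q| := by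
  have hU : 0 < √(k / q) := sqrt_pos.mpr (by positivity)
  rcases eq_or_ne k q with rfl | hne
  · rw [div_self hk.ne']
    simp only [sqrt_one, inv_one, sub_self, abs_zero, div_zero, mul_zero, add_zero]
    positivity
  have hU1 : √(k / q) ≠ 1 := by
    rw [Ne, sqrt_eq_one, div_eq_one_iff_eq hq.ne']
    exact hne
  have h1 := one_div_abs_sqrt_sub_inv_le hU hU1
  rw [sq_sqrt (by positivity), show k / q - 1 = (k - q) / q by field_simp, abs_div,
    abs_of_pos hq, one_div_div] at h1
  have hqk : q ≤ |k - q| + k := by linarith [neg_abs_le (k - q)]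
  calc _ ≤ 1 / (π * k) * (2 * (1 + q / |k - q|)) := by gcongr
    _ = 2 / π * (1 / k * (1 + q / |k - q|)) := by field_simp
    _ ≤ 1 * (1 / k * (1 + q / |k - q|)) := by
        gcongr
        rw [div_le_one pi_pos]
        linarith [pi_gt_three]
    _ ≤ 1 * (1 / k * (1 + (|k - q| + k) / |k - q|)) := by gcongr
    _ = _ := by field_simp; ring

theorem norm_stationary_sub_voronoiTerm_le_add_fresnel {x h k ρ : ℝ} (hx : 0 < x) (hh : 0 < h)
    (hk : 0 < k) (hρ : 0 < ρ) (hhρ : h ^ 2 ≤ ρ) :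
    ‖(1 / h : ℝ) * (∫ t in (h * x / √ρ)..x,
        Complex.exp (Complex.I * (2 * π * (h * x ^ 2 / t + k * t) : ℝ)))
      - voronoiTerm x (h * k) * ((Real.sign (k - h) - Real.sign (h * k - ρ) : ℝ) : ℂ)‖
      ≤ 1 / h * (3 / k + 1 / |k - h| + x * √(h * k) / k *
        ‖fresnel (2 * π * x * √(h * k)) (√√(k / (ρ / h)) - (√√(k / (ρ / h)))⁻¹) -
          Real.sign (√√(k / (ρ / h)) - (√√(k / (ρ / h)))⁻¹) *
            fresnelLimit (2 * π * x * √(h * k))‖) := by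
  set s := √(h * k) with hs
  have hs0 : 0 < s := sqrt_pos.mpr (by positivity)
  have hs2 : s ^ 2 = h * k := sq_sqrt (by positivity)
  have hr0 : 0 < √ρ := sqrt_pos.mpr hρ
  have hhr : h ≤ √ρ := le_sqrt_of_sq_le hhρ
  set L := 2 * π * x * s with hL
  have hL0 : 0 < L := by positivity
  set c := x * s / k with hc
  have hc0 : 0 < c := by positivity
  have hA0 : 0 < h * x / √ρ := by positivity
  have hAB : h * x / √ρ ≤ x := by
    rw [div_le_iff₀ hr0, mul_comm]
    gcongr
  have hst := norm_integral_stationary_sub_fresnel_le hL0 hc0 hA0 hAB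
  have eB : √(k / h) = x / c := by
    rw [hc, show k / h = (k / s) ^ 2 by rw [div_pow, hs2]; field_simp, sqrt_sq (by positivity)]
    field_simp
  have eA : √(k / (ρ / h)) = h * x / √ρ / c := by
    rw [hc, show k / (ρ / h) = (s / √ρ) ^ 2 by rw [div_pow, hs2, sq_sqrt hρ.le]; field_simp,
      sqrt_sq (by positivity)]
    field_simp
    exact hs2
  rw [← eA, ← eB] at hst
  have hcongr : ∀ t ∈ Set.uIcc (h * x / √ρ) x,
      Complex.exp (Complex.I * (2 * π * (h * x ^ 2 / t + k * t) : ℝ)) =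
        Complex.exp (Complex.I * (L * (t / c + c / t) : ℝ)) := fun t ht => by
    rw [Set.uIcc_of_le hAB] at ht
    congr 3
    rw [hL, hc]
    field_simp
    rw [hs2]
    ring
  rw [intervalIntegral.integral_congr hcongr]
  have hB := norm_fresnel_sub_sign_le hL0 (√√(k / h) - (√√(k / h))⁻¹)
  have sB : Real.sign (√√(k / h) - (√√(k / h))⁻¹) = Real.sign (k - h) := by
    rw [sign_sqrt_sub_inv (sqrt_pos.mpr (by positivity)), sq_sqrt (by positivity),
      sign_div_sub_one hh]
  have sA : Real.sign (√√(k / (ρ / h)) - (√√(k / (ρ / h)))⁻¹) = Real.sign (h * k - ρ) := by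
    rw [sign_sqrt_sub_inv (sqrt_pos.mpr (by positivity)), sq_sqrt (by positivity),
      show k / (ρ / h) = h * k / ρ by field_simp, sign_div_sub_one hρ]
  have hcB : c * ‖fresnel L (√√(k / h) - (√√(k / h))⁻¹) -
      Real.sign (√√(k / h) - (√√(k / h))⁻¹) * fresnelLimit L‖ ≤ 2 / k + 1 / |k - h| := by
    refine le_trans ?_ (one_div_mul_one_div_abs_sqrt_sub_inv_le hk hh)
    calc _ ≤ c * (2 / (L * |√√(k / h) - (√√(k / h))⁻¹|)) := by gcongr
      _ = _ := by
        rw [hc, hL]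
        field_simp
  rw [sB] at hcB
  rw [sA]
  have h4 : 4 * c / L ≤ 1 / k := by
    rw [hc, hL, div_le_div_iff₀ (by positivity) hk]
    have : 4 * (x * s / k) * k = 4 * (x * s) := by field_simp
    rw [this]
    nlinarith [pi_gt_three, mul_pos hx hs0]
  set J := ∫ t in (h * x / √ρ)..x, Complex.exp (Complex.I * (L * (t / c + c / t) : ℝ)) with hJ
  set fB := fresnel L (√√(k / h) - (√√(k / h))⁻¹)
  set fA := fresnel L (√√(k / (ρ / h)) - (√√(k / (ρ / h)))⁻¹)
  set σB := Real.sign (k - h)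
  set σA := Real.sign (h * k - ρ)
  rw [voronoiTerm_eq hx hh hk, ← hs, ← hL, ← hc]
  set e := Complex.exp (Complex.I * (2 * L : ℝ)) with he
  have hen : ‖e‖ = 1 := by rw [he, mul_comm, Complex.norm_exp_ofReal_mul_I]
  have key : ((1 / h : ℝ) : ℂ) * J - ((1 / h : ℝ) : ℂ) * (c * e * fresnelLimit L) *
      ((σB - σA : ℝ) : ℂ) = ((1 / h : ℝ) : ℂ) * ((J - c * e * (fB - fA)) +
        (c * e * (fB - σB * fresnelLimit L) - c * e * (fA - σA * fresnelLimit L))) := by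
    push_cast
    ring
  rw [key, norm_mul, Complex.norm_real, norm_of_nonneg (by positivity)]
  gcongr
  calc _ ≤ ‖J - c * e * (fB - fA)‖ + (‖c * e * (fB - σB * fresnelLimit L)‖ +
        ‖c * e * (fA - σA * fresnelLimit L)‖) :=
        (norm_add_le _ _).trans (by gcongr; exact norm_sub_le _ _)
    _ ≤ 1 / k + ((2 / k + 1 / |k - h|) + c * ‖fA - σA * fresnelLimit L‖) := by
        simp only [norm_mul, Complex.norm_real, norm_of_nonneg hc0.le, hen, mul_one]
        gcongr
        exact hst.trans h4
    _ = _ := by ring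

theorem norm_stationary_sub_voronoiTerm_le {x h k ρ : ℝ} (hx : 0 < x) (hh : 0 < h)
    (hk : 0 < k) (hρ : 0 < ρ) (hhρ : h ^ 2 ≤ ρ) :
    ‖(1 / h : ℝ) * (∫ t in (h * x / √ρ)..x,
        Complex.exp (Complex.I * (2 * π * (h * x ^ 2 / t + k * t) : ℝ)))
      - voronoiTerm x (h * k) * ((Real.sign (k - h) - Real.sign (h * k - ρ) : ℝ) : ℂ)‖
      ≤ 1 / h * (5 / k + 1 / |k - h| + 1 / |k - ρ / h|) := by
  refine (norm_stationary_sub_voronoiTerm_le_add_fresnel hx hh hk hρ hhρ).trans ?_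
  have hq : 0 < ρ / h := by positivity
  refine mul_le_mul_of_nonneg_left ?_ (by positivity)
  have h1 := one_div_mul_one_div_abs_sqrt_sub_inv_le hk hq
  calc _ ≤ 3 / k + 1 / |k - h| + x * √(h * k) / k * (2 / (2 * π * x * √(h * k) *
        |√√(k / (ρ / h)) - (√√(k / (ρ / h)))⁻¹|)) := by
        gcongr
        exact norm_fresnel_sub_sign_le (by positivity) _
    _ = 3 / k + 1 / |k - h| +
        1 / (π * k) * (1 / |√√(k / (ρ / h)) - (√√(k / (ρ / h)))⁻¹|) := by
        congr 1
        field_simp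
    _ ≤ 3 / k + 1 / |k - h| + (2 / k + 1 / |k - ρ / h|) := by gcongr
    _ = _ := by ring

theorem norm_stationary_sub_voronoiTerm_le_of_le {x h k ρ : ℝ} (hx : 0 < x) (hh : 0 < h)
    (hk : 0 < k) (hρ : 0 < ρ) (hhρ : h ^ 2 ≤ ρ) (hkρ : ρ ≤ 2 * (h * k)) :
    ‖(1 / h : ℝ) * (∫ t in (h * x / √ρ)..x,
        Complex.exp (Complex.I * (2 * π * (h * x ^ 2 / t + k * t) : ℝ)))
      - voronoiTerm x (h * k) * ((Real.sign (k - h) - Real.sign (h * k - ρ) : ℝ) : ℂ)‖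
      ≤ 1 / h * (5 / k + 1 / |k - h|) + 2 * √(x / √ρ) / √ρ := by
  refine (norm_stationary_sub_voronoiTerm_le_add_fresnel hx hh hk hρ hhρ).trans ?_
  set s := √(h * k) with hs
  have hs0 : 0 < s := sqrt_pos.mpr (by positivity)
  have hs2 : s ^ 2 = h * k := sq_sqrt (by positivity)
  have hr2 : √ρ ^ 2 = ρ := sq_sqrt hρ.le
  have hL0 : 0 < 2 * π * x * s := by positivity
  have h1 : x * s / k * (2 / √(2 * π * x * s)) ≤ 2 * h * √(x / √ρ) / √ρ := by
    refine abs_le_of_sq_le_sq' ?_ (by positivity) |>.2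
    rw [mul_pow, div_pow, div_pow, div_pow, mul_pow, mul_pow, mul_pow, sq_sqrt hL0.le,
      sq_sqrt (show 0 ≤ x / √ρ by positivity), hr2, hs2]
    have h2 : s * √ρ * ρ ≤ 2 * π * s ^ 4 := by
      have a1 : ρ ≤ 2 * s ^ 2 := by rw [hs2]; exact hkρ
      have a2 : √ρ ≤ 2 * s := by
        refine abs_le_of_sq_le_sq' ?_ (by positivity) |>.2
        rw [hr2]
        nlinarith [sq_nonneg s]
      calc s * √ρ * ρ ≤ s * (2 * s) * (2 * s ^ 2) := by gcongr
        _ = 4 * s ^ 4 := by ring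
        _ ≤ 2 * π * s ^ 4 := by
          gcongr
          linarith [pi_gt_three]
    have e1 : x ^ 2 * (h * k) / k ^ 2 * (2 ^ 2 / (2 * π * x * s)) =
        4 * x * (h * k) / (k ^ 2 * (2 * π * s)) := by
      field_simp
      norm_num
    have e2 : 2 ^ 2 * h ^ 2 * (x / √ρ) / ρ = 4 * x * h ^ 2 / (√ρ * ρ) := by
      field_simp
      norm_num
    rw [e1, e2, div_le_div_iff₀ (by positivity) (by positivity)]
    have e3 : s ^ 4 = h ^ 2 * k ^ 2 := by
      rw [show s ^ 4 = (s ^ 2) ^ 2 by ring, hs2]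
      ring
    rw [e3] at h2
    refine le_of_mul_le_mul_right ?_ hs0
    calc 4 * x * (h * k) * (√ρ * ρ) * s = 4 * x * (h * k) * (s * √ρ * ρ) := by ring
      _ ≤ 4 * x * (h * k) * (2 * π * (h ^ 2 * k ^ 2)) := by gcongr
      _ = 4 * x * h ^ 2 * (k ^ 2 * (2 * π)) * s ^ 2 := by rw [hs2]; ring
      _ = _ := by ring
  calc _ ≤ 1 / h * (3 / k + 1 / |k - h| + x * s / k * (2 / √(2 * π * x * s))) := by
        gcongr
        exact norm_fresnel_sub_sign_le_inv_sqrt hL0 _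
    _ ≤ 1 / h * (5 / k + 1 / |k - h| + 2 * h * √(x / √ρ) / √ρ) := by
        gcongr
        norm_num
    _ = _ := by
        field_simp

theorem sum_card_divisors_mul_eq_sum_product (M : ℕ) (G : ℕ × ℕ → ℝ) :
    ∑ n ∈ Finset.Icc 1 M, ∑ p ∈ n.divisorsAntidiagonal, G p =
      ∑ p ∈ (Finset.Icc 1 M ×ˢ Finset.Icc 1 M) with p.1 * p.2 ≤ M, G p := by
  rw [← Finset.sum_fiberwise_of_maps_to (t := Finset.Icc 1 M) (g := fun p : ℕ × ℕ => p.1 * p.2)]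
  · refine Finset.sum_congr rfl fun n hn => Finset.sum_congr ?_ fun _ _ => rfl
    ext ⟨a, b⟩
    simp only [Nat.mem_divisorsAntidiagonal, Finset.mem_filter, Finset.mem_product,
      Finset.mem_Icc] at hn ⊢
    constructor
    · rintro ⟨rfl, h0⟩
      have ha : 0 < a := Nat.pos_of_ne_zero fun h => by simp [h] at h0
      have hb : 0 < b := Nat.pos_of_ne_zero fun h => by simp [h] at h0
      exact ⟨⟨⟨⟨ha, (Nat.le_mul_of_pos_right a hb).trans hn.2⟩,
        hb, (Nat.le_mul_of_pos_left b ha).trans hn.2⟩, hn.2⟩, rfl⟩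
    · rintro ⟨-, rfl⟩
      exact ⟨rfl, by omega⟩
  · rintro ⟨a, b⟩ h
    simp only [Finset.mem_filter, Finset.mem_product, Finset.mem_Icc] at h ⊢
    exact ⟨Nat.mul_pos h.1.1.1 h.1.2.1, h.2⟩

/-- A weighted form of Dirichlet's hyperbola method. -/
theorem sum_card_divisors_mul_eq_sum_sqrt (M : ℕ) (g : ℕ → ℝ) :
    ∑ n ∈ Finset.Icc 1 M, (n.divisors.card : ℝ) * g n =
      ∑ h ∈ Finset.Icc 1 M.sqrt, ∑ k ∈ Finset.Icc 1 (M / h),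
        g (h * k) * (1 + Real.sign ((k : ℝ) - h)) := by
  set S := {p ∈ Finset.Icc 1 M ×ˢ Finset.Icc 1 M | p.1 * p.2 ≤ M} with hS
  have h1 : ∑ n ∈ Finset.Icc 1 M, (n.divisors.card : ℝ) * g n = ∑ p ∈ S, g (p.1 * p.2) := by
    rw [hS, ← sum_card_divisors_mul_eq_sum_product M fun p => g (p.1 * p.2)]
    refine Finset.sum_congr rfl fun n _ => ?_
    rw [Finset.sum_congr rfl (g := fun _ => g n) fun p hp => by
      rw [(Nat.mem_divisorsAntidiagonal.mp hp).1]]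
    rw [Finset.sum_const, nsmul_eq_mul, ← Nat.map_div_right_divisors, Finset.card_map]
  have h2 : ∑ p ∈ S, g (p.1 * p.2) * Real.sign ((p.2 : ℝ) - p.1) = 0 := by
    have : ∑ p ∈ S, g (p.1 * p.2) * Real.sign ((p.2 : ℝ) - p.1) =
        ∑ p ∈ S, -(g (p.1 * p.2) * Real.sign ((p.2 : ℝ) - p.1)) := by
      refine Finset.sum_nbij' Prod.swap Prod.swap ?_ ?_ (fun _ _ => rfl) (fun _ _ => rfl) ?_
      · rintro ⟨a, b⟩ h
        simp only [hS, Finset.mem_filter, Finset.mem_product, Prod.swap] at h ⊢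
        exact ⟨h.1.symm, by rw [mul_comm]; exact h.2⟩
      · rintro ⟨a, b⟩ h
        simp only [hS, Finset.mem_filter, Finset.mem_product, Prod.swap] at h ⊢
        exact ⟨h.1.symm, by rw [mul_comm]; exact h.2⟩
      · rintro ⟨a, b⟩ -
        simp only [Prod.swap]
        rw [mul_comm b a, ← neg_sub (b : ℝ) a, Real.sign_neg]
        ring
    rw [Finset.sum_neg_distrib] at this
    linarith
  have h3 : ∑ h ∈ Finset.Icc 1 M.sqrt, ∑ k ∈ Finset.Icc 1 (M / h),
      g (h * k) * (1 + Real.sign ((k : ℝ) - h)) =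
      ∑ p ∈ S, g (p.1 * p.2) * (1 + Real.sign ((p.2 : ℝ) - p.1)) := by
    rw [Finset.sum_sigma']
    refine Finset.sum_bij_ne_zero (fun p _ _ => (p.1, p.2)) ?_ ?_ ?_ ?_
    · rintro ⟨a, b⟩ h -
      simp only [hS, Finset.mem_filter, Finset.mem_product, Finset.mem_sigma,
        Finset.mem_Icc] at h ⊢
      have hab : a * b ≤ M := (Nat.mul_le_mul_left a h.2.2).trans (Nat.mul_div_le M a)
      exact ⟨⟨⟨h.1.1, h.1.2.trans (Nat.sqrt_le_self M)⟩, h.2.1,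
        h.2.2.trans (Nat.div_le_self M a)⟩, hab⟩
    · rintro ⟨a, b⟩ _ _ ⟨c, d⟩ _ _ h
      simp only [Prod.mk.injEq] at h
      simp [h.1, h.2]
    · rintro ⟨a, b⟩ h hne
      simp only [hS, Finset.mem_filter, Finset.mem_product, Finset.mem_Icc] at h
      have hab : a ≤ b := by
        by_contra hlt
        push Not at hlt
        apply hne
        have : (b : ℝ) < a := by exact_mod_cast hlt
        rw [Real.sign_of_neg (by simpa using this)]
        simp
      refine ⟨⟨a, b⟩, ?_, hne, rfl⟩
      simp only [Finset.mem_sigma, Finset.mem_Icc]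
      refine ⟨⟨h.1.1.1, Nat.le_sqrt.mpr ((Nat.mul_le_mul_left a hab).trans h.2)⟩, h.1.2.1, ?_⟩
      rw [Nat.le_div_iff_mul_le h.1.1.1, mul_comm]
      exact h.2
    · rintro ⟨a, b⟩ _ _
      rfl
  rw [h1, h3]
  simp only [mul_add, mul_one, Finset.sum_add_distrib]
  rw [h2, add_zero]

theorem sum_one_add_sign_sub {h m : ℕ} (hh : 1 ≤ h) (hm : h ≤ m) :
    ∑ k ∈ Finset.Icc 1 m, (1 + Real.sign ((k : ℝ) - h)) = 2 * m - 2 * h + 1 := by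
  induction m, hm using Nat.le_induction with
  | base =>
    rw [Finset.sum_eq_single h]
    · simp
    · intro k hk hne
      have : (k : ℝ) < h := by
        exact_mod_cast lt_of_le_of_ne (Finset.mem_Icc.mp hk).2 hne
      rw [Real.sign_of_neg (by linarith)]
      norm_num
    · intro hn
      exact absurd (Finset.mem_Icc.mpr ⟨hh, le_rfl⟩) hn
  | succ m hm ih =>
    rw [Finset.sum_Icc_succ_top (by omega), ih]
    have : (h : ℝ) ≤ m := by exact_mod_cast hm
    rw [Real.sign_of_pos (by push_cast; linarith)]
    push_cast
    ring

theorem sum_card_divisors_eq (M : ℕ) :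
    ∑ n ∈ Finset.Icc 1 M, (n.divisors.card : ℝ) =
      2 * ∑ a ∈ Finset.Icc 1 M.sqrt, ((M / a : ℕ) : ℝ) - (M.sqrt : ℝ) ^ 2 := by
  have h := sum_card_divisors_mul_eq_sum_sqrt M fun _ => 1
  simp only [mul_one, one_mul] at h
  rw [h, Finset.sum_congr rfl fun a ha => sum_one_add_sign_sub (Finset.mem_Icc.mp ha).1 ?_]
  · have e : ∀ m : ℕ, ∑ a ∈ Finset.Icc 1 m, (2 * (a : ℝ) - 1) = (m : ℝ) ^ 2 := fun m => by
      induction m with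
      | zero => simp
      | succ m ih =>
        rw [Finset.sum_Icc_succ_top (by omega), ih]
        push_cast
        ring
    rw [← e, Finset.mul_sum, ← Finset.sum_sub_distrib]
    exact Finset.sum_congr rfl fun _ _ => by ring
  · rw [Finset.mem_Icc] at ha
    rw [Nat.le_div_iff_mul_le ha.1]
    exact Nat.le_sqrt.mp ha.2

theorem two_div_two_mul_add_one_le_log_sub {t : ℝ} (ht : 0 < t) :
    2 / (2 * t + 1) ≤ log (t + 1) - log t := by
  have h := le_log_one_add_of_nonneg (inv_nonneg.mpr ht.le)
  rw [← log_div (by positivity) ht.ne', show (t + 1) / t = 1 + t⁻¹ by field_simp]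
  refine le_trans (le_of_eq ?_) h
  field_simp
  ring

theorem log_sub_le_inv_add_inv_div_two {t : ℝ} (ht : 0 < t) :
    log (t + 1) - log t ≤ (1 / t + 1 / (t + 1)) / 2 := by
  rw [← log_div (by positivity) ht.ne']
  have h1 : 0 ≤ log ((t + 1) / t) := log_nonneg (by rw [le_div_iff₀ ht]; linarith)
  have h := self_le_sinh_iff.mpr h1
  rw [sinh_log (by positivity)] at h
  refine h.trans (le_of_eq ?_)
  field_simp
  ring

theorem abs_sum_inv_sub_log_le {m : ℕ} (hm : 1 ≤ m) :
    |∑ a ∈ Finset.Icc 1 m, 1 / (a : ℝ) - log m - eulerMascheroniConstant - 1 / (2 * m)|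
      ≤ 1 / (m : ℝ) ^ 2 := by
  set u : ℕ → ℝ := fun n => ∑ a ∈ Finset.Icc 1 (n + 1), 1 / (a : ℝ) - log (n + 1) -
    1 / (2 * (n + 1)) with hu
  have hstep : ∀ n : ℕ, u (n + 1) - u n = (1 / ((n : ℝ) + 1) + 1 / ((n : ℝ) + 1 + 1)) / 2 -
      (log ((n : ℝ) + 1 + 1) - log ((n : ℝ) + 1)) := fun n => by
    simp only [hu]
    rw [Finset.sum_Icc_succ_top (by omega : 1 ≤ n + 1 + 1)]
    push_cast
    field_simp
    ring
  have hlim : Filter.Tendsto u Filter.atTop (nhds eulerMascheroniConstant) := by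
    have h1 := tendsto_eulerMascheroniSeq'.comp (Filter.tendsto_add_atTop_nat 1)
    have h2 : Filter.Tendsto (fun n : ℕ => 1 / (2 : ℝ) * (1 / ((n : ℝ) + 1))) Filter.atTop
        (nhds (1 / 2 * 0)) := tendsto_one_div_add_atTop_nhds_zero_nat.const_mul _
    have h3 := h1.sub h2
    rw [mul_zero, sub_zero] at h3
    refine h3.congr fun n => ?_
    simp only [hu, Function.comp_apply, eulerMascheroniSeq', Nat.succ_ne_zero, if_false,
      harmonic_eq_sum_Icc, Rat.cast_sum, one_div, mul_inv]
    push_cast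
    ring
  have hlim2 : Filter.Tendsto (fun n : ℕ => u n + 1 / ((n : ℝ) + 1) ^ 2) Filter.atTop
      (nhds eulerMascheroniConstant) := by
    have h2 := (tendsto_one_div_add_atTop_nhds_zero_nat (𝕜 := ℝ)).pow 2
    have h3 := hlim.add h2
    simp only [one_div, inv_pow] at h3 ⊢
    simpa using h3
  have hmono : Monotone u := monotone_nat_of_le_succ fun n => by
    have := hstep n
    have := log_sub_le_inv_add_inv_div_two (t := (n : ℝ) + 1) (by positivity)
    linarith
  have hanti : Antitone fun n : ℕ => u n + 1 / ((n : ℝ) + 1) ^ 2 :=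
    antitone_nat_of_succ_le fun n => by
    have h1 := hstep n
    have h2 := two_div_two_mul_add_one_le_log_sub (t := (n : ℝ) + 1) (by positivity)
    set t : ℝ := (n : ℝ) + 1 with ht
    have ht0 : 0 < t := by positivity
    have h3 : (1 / t + 1 / (t + 1)) / 2 - 2 / (2 * t + 1) ≤ 1 / t ^ 2 - 1 / (t + 1) ^ 2 := by
      have e1 : (1 / t + 1 / (t + 1)) / 2 - 2 / (2 * t + 1) =
          1 / (2 * t * (t + 1) * (2 * t + 1)) := by
        field_simp
        ring
      have e2 : 1 / t ^ 2 - 1 / (t + 1) ^ 2 = (2 * t + 1) / (t ^ 2 * (t + 1) ^ 2) := by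
        field_simp
        ring
      rw [e1, e2, div_le_div_iff₀ (by positivity) (by positivity)]
      have : 0 < t * (t + 1) := by positivity
      nlinarith [mul_pos this this, mul_pos this ht0, mul_pos ht0 ht0,
        mul_pos this (mul_pos ht0 ht0)]
    push_cast
    rw [← ht]
    linarith
  obtain ⟨n, rfl⟩ : ∃ n, m = n + 1 := ⟨m - 1, by omega⟩
  have h1 := hmono.ge_of_tendsto hlim n
  have h2 := hanti.le_of_tendsto hlim2 n
  simp only [hu] at h1 h2
  push_cast
  rw [abs_le]
  constructor <;> linarith

theorem abs_divisorError_add_sum_fract_le {x : ℝ} (hx : 1 ≤ x) :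
    |divisorError (x ^ 2) + 2 * ∑ a ∈ Finset.Icc 1 ⌊x⌋₊, (Int.fract (x ^ 2 / a) - 1 / 2)| ≤ 40 := by
  have hx0 : 0 < x := by linarith
  set m := ⌊x⌋₊ with hm
  have hm1 : 1 ≤ m := Nat.one_le_floor_iff x |>.mpr hx
  have hmx : (m : ℝ) ≤ x := Nat.floor_le hx0.le
  have hxm : x < m + 1 := Nat.lt_floor_add_one x
  have hm1' : (1 : ℝ) ≤ m := by exact_mod_cast hm1
  have hm0 : (0 : ℝ) < m := by linarith
  have hsqrt : ⌊x ^ 2⌋₊.sqrt = m := by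
    refine (Nat.eq_sqrt.mpr ⟨?_, ?_⟩).symm
    · rw [Nat.le_floor_iff (by positivity)]
      push_cast
      nlinarith
    · rw [Nat.floor_lt (by positivity)]
      push_cast
      nlinarith
  have hdiv : ∀ a ∈ Finset.Icc 1 m, ((⌊x ^ 2⌋₊ / a : ℕ) : ℝ) =
      x ^ 2 * (1 / a) - (Int.fract (x ^ 2 / a) - 1 / 2) - 1 / 2 := fun a _ => by
    rw [← Nat.floor_div_natCast, natCast_floor_eq_intCast_floor (by positivity)]
    have := Int.self_sub_floor (x ^ 2 / a)
    rw [mul_one_div]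
    linarith
  have hE := abs_sum_inv_sub_log_le hm1
  rw [divisorError, sum_card_divisors_eq, hsqrt, Finset.sum_congr rfl hdiv]
  simp only [Finset.sum_sub_distrib, Finset.sum_const, ← Finset.mul_sum, Nat.card_Icc,
    Nat.add_sub_cancel, nsmul_eq_mul]
  set H := ∑ a ∈ Finset.Icc 1 m, 1 / (a : ℝ)
  set E := H - log m - eulerMascheroniConstant - 1 / (2 * m) with hEdef
  have hH : H = E + log m + eulerMascheroniConstant + 1 / (2 * m) := by rw [hEdef]; ring
  set f := x - m with hf
  have hf0 : 0 ≤ f := by linarith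
  have hf1 : f ≤ 1 := by linarith
  have hxf : x = m + f := by rw [hf]; ring
  set l := log x - log m with hl
  have hlog : l = log (1 + f / m) := by
    rw [hl, ← log_div hx0.ne' hm0.ne']
    congr 1
    rw [hxf]
    field_simp
  have hl1 : l ≤ f / m := by
    rw [hlog]
    linarith [log_le_sub_one_of_pos (show 0 < 1 + f / m by positivity)]
  have hl2 : f / m - (f / m) ^ 2 ≤ l := by
    rw [hlog]
    refine le_trans ?_ (le_log_one_add_of_nonneg (show 0 ≤ f / m by positivity))
    have : 0 ≤ f / m := by positivity
    rw [le_div_iff₀ (by positivity)]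
    nlinarith [pow_nonneg this 3, pow_nonneg this 2]
  have hlogx : log (x ^ 2) = 2 * (log m + l) := by
    rw [log_pow, hl]
    push_cast
    ring
  have hx2m : x ^ 2 / m ^ 2 ≤ 4 := by
    rw [div_le_iff₀ (by positivity)]
    nlinarith
  have hE2 : |2 * x ^ 2 * E| ≤ 8 := by
    rw [abs_mul, abs_of_nonneg (by positivity)]
    calc 2 * x ^ 2 * |E| ≤ 2 * x ^ 2 * (1 / (m : ℝ) ^ 2) := by gcongr
      _ = 2 * (x ^ 2 / m ^ 2) := by ring
      _ ≤ 8 := by linarith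
  have hl3 : |2 * x ^ 2 * (f / m - l)| ≤ 8 := by
    rw [abs_mul, abs_of_nonneg (by positivity), abs_of_nonneg (by linarith)]
    calc 2 * x ^ 2 * (f / m - l) ≤ 2 * x ^ 2 * (1 / (m : ℝ)) ^ 2 := by
          gcongr
          have : (f / m) ^ 2 ≤ (1 / (m : ℝ)) ^ 2 := by gcongr
          linarith
      _ = 2 * (x ^ 2 / m ^ 2) := by ring
      _ ≤ 8 := by linarith
  have hg : |x ^ 2 / m - m - m ^ 2 + x ^ 2 - 2 * x ^ 2 * (f / m)| ≤ 8 := by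
    have e : x ^ 2 / m - m - m ^ 2 + x ^ 2 - 2 * x ^ 2 * (f / m) =
        2 * f - 3 * f ^ 2 + f ^ 2 / m - 2 * (f ^ 3 / m) := by
      rw [hxf]
      field_simp
      ring
    have b1 : f ^ 2 / m ≤ 1 := by
      rw [div_le_one hm0]
      nlinarith
    have b2 : f ^ 3 / m ≤ 1 := by
      rw [div_le_one hm0]
      exact (pow_le_one₀ hf0 hf1).trans hm1'
    have b3 : 0 ≤ f ^ 2 / m := by positivity
    have b4 : 0 ≤ f ^ 3 / m := by positivity
    rw [e, abs_le]
    constructor <;> nlinarith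
  rw [hlogx, hH]
  have e3 : ∀ S : ℝ, 2 * (x ^ 2 * (E + log m + eulerMascheroniConstant + 1 / (2 * m)) -
      (S - m * (1 / 2)) - m * (1 / 2)) - m ^ 2 - x ^ 2 * (2 * (log m + l)) -
      (2 * eulerMascheroniConstant - 1) * x ^ 2 + 2 * (S - m * (1 / 2)) =
      2 * x ^ 2 * E + (x ^ 2 / m - m - m ^ 2 + x ^ 2 - 2 * x ^ 2 * (f / m)) +
        2 * x ^ 2 * (f / m - l) := fun S => by
    field_simp
    ring
  rw [e3]
  refine (abs_add_three _ _ _).trans ?_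
  linarith

theorem exists_card_divisors_le_rpow {ε : ℝ} (hε : 0 < ε) :
    ∃ C : ℝ, 1 ≤ C ∧ ∀ n : ℕ, 1 ≤ n → (n.divisors.card : ℝ) ≤ C * (n : ℝ) ^ ε := by
  set P := ⌈(2 : ℝ) ^ (1 / ε)⌉₊ with hP
  set c := max 1 (1 / (ε * log 2)) with hc
  have hc1 : 1 ≤ c := le_max_left _ _
  refine ⟨c ^ P, one_le_pow₀ hc1, fun n hn => ?_⟩
  have hn0 : n ≠ 0 := by omega
  have hterm : ∀ p ∈ n.primeFactors, ((n.factorization p + 1 : ℕ) : ℝ) ≤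
      (if p < P then c else 1) * ((p ^ n.factorization p : ℕ) : ℝ) ^ ε := fun p hp => by
    set e := n.factorization p
    have hp2 : (2 : ℝ) ≤ p := by exact_mod_cast (Nat.prime_of_mem_primeFactors hp).two_le
    have hpe : ((p ^ e : ℕ) : ℝ) ^ ε = ((p : ℝ) ^ ε) ^ e := by
      push_cast
      rw [← rpow_natCast, ← rpow_natCast, ← rpow_mul (by linarith), ← rpow_mul (by linarith),
        mul_comm]
    rw [hpe]
    split_ifs with h
    · have h2 : 1 + e * (ε * log 2) ≤ ((p : ℝ) ^ ε) ^ e := by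
        calc 1 + e * (ε * log 2) ≤ exp (e * (ε * log 2)) := by
              linarith [add_one_le_exp (e * (ε * log 2))]
          _ = ((2 : ℝ) ^ ε) ^ e := by
              rw [rpow_def_of_pos two_pos, ← exp_nat_mul]
              congr 1
              ring
          _ ≤ _ := by gcongr
      have h3 : 1 ≤ c * (ε * log 2) := by
        calc (1 : ℝ) = 1 / (ε * log 2) * (ε * log 2) := by field_simp
          _ ≤ _ := by gcongr; exact le_max_right _ _
      calc ((e + 1 : ℕ) : ℝ) ≤ c * (1 + e * (ε * log 2)) := by
            push_cast
            have : (e : ℝ) * 1 ≤ e * (c * (ε * log 2)) := by gcongr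
            linarith
        _ ≤ _ := by gcongr
    · have h2 : (2 : ℝ) ≤ (p : ℝ) ^ ε := by
        push Not at h
        have h1 : (2 : ℝ) ^ (1 / ε) ≤ p := (Nat.le_ceil _).trans (by exact_mod_cast h)
        calc (2 : ℝ) = ((2 : ℝ) ^ (1 / ε)) ^ ε := by
              rw [← rpow_mul two_pos.le, one_div_mul_cancel hε.ne', rpow_one]
          _ ≤ _ := by gcongr
      rw [one_mul]
      calc ((e + 1 : ℕ) : ℝ) ≤ ((2 ^ e : ℕ) : ℝ) := by exact_mod_cast Nat.lt_two_pow_self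
        _ = (2 : ℝ) ^ e := by push_cast; rfl
        _ ≤ _ := by gcongr
  rw [Nat.card_divisors hn0]
  push_cast
  calc _ ≤ ∏ p ∈ n.primeFactors,
        ((if p < P then c else 1) * ((p ^ n.factorization p : ℕ) : ℝ) ^ ε) := by
        refine Finset.prod_le_prod (fun _ _ => by positivity) fun p hp => ?_
        simpa using hterm p hp
    _ = (∏ p ∈ n.primeFactors, if p < P then c else 1) * (n : ℝ) ^ ε := by
        rw [Finset.prod_mul_distrib, finsetProd_rpow _ _ fun _ _ => by positivity]
        congr 2
        rw [← Nat.cast_prod]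
        congr 1
        exact Nat.prod_factorization_pow_eq_self hn0
    _ ≤ c ^ P * (n : ℝ) ^ ε := by
        gcongr
        rw [Finset.prod_ite, Finset.prod_const, Finset.prod_const, one_pow, mul_one]
        refine pow_le_pow_right₀ hc1 ?_
        calc _ ≤ (Finset.range P).card := Finset.card_le_card fun p hp => by
              simpa using (Finset.mem_filter.mp hp).2
          _ = P := Finset.card_range P

theorem sum_Icc_one_div_le (K : ℕ) : ∑ k ∈ Finset.Icc 1 K, 1 / (k : ℝ) ≤ 1 + log K := by
  have h := harmonic_le_one_add_log K
  rw [harmonic_eq_sum_Icc] at h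
  push_cast at h
  simpa [one_div] using h

theorem sum_one_div_comp_le {ι : Type*} (s : Finset ι) (j : ι → ℕ) (K : ℕ)
    (hj : ∀ i ∈ s, j i ∈ Finset.Icc 1 K) (hinj : Set.InjOn j s) :
    ∑ i ∈ s, 1 / (j i : ℝ) ≤ 1 + log K := by
  classical
  rw [← Finset.sum_image (f := fun k : ℕ => 1 / (k : ℝ)) hinj]
  exact (Finset.sum_le_sum_of_subset_of_nonneg (Finset.image_subset_iff.mpr hj)
    fun _ _ _ => by positivity).trans (sum_Icc_one_div_le K)

theorem sum_le_of_le_div_dist {f : ℕ → ℝ} {m K : ℕ} {Q R : ℝ} (hQ : 0 ≤ Q) (hR : 0 ≤ R)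
    (hm : m ≤ K) (h0 : f m ≤ Q) (h1 : f (m + 1) ≤ Q)
    (hlt : ∀ k ∈ Finset.Icc 1 K, k < m → f k ≤ R / ((m : ℝ) - k))
    (hgt : ∀ k ∈ Finset.Icc 1 K, m + 1 < k → f k ≤ R / ((k : ℝ) - m - 1)) :
    ∑ k ∈ Finset.Icc 1 K, f k ≤ 2 * Q + 2 * R * (1 + log K) := by
  have hle : ∀ k ∈ Finset.Icc 1 K, f k ≤ ((if k = m then Q else 0) +
      (if k = m + 1 then Q else 0)) + ((if k < m then R * (1 / ((m - k : ℕ) : ℝ)) else 0) +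
      (if m + 1 < k then R * (1 / ((k - m - 1 : ℕ) : ℝ)) else 0)) := fun k hk => by
    rcases lt_trichotomy k m with h | h | h
    · rw [if_neg h.ne, if_neg (by omega), if_pos h, if_neg (by omega), Nat.cast_sub h.le]
      have := hlt k hk h
      rw [mul_one_div]
      linarith
    · rw [if_pos h, if_neg (by omega), if_neg (by omega), if_neg (by omega), h]
      linarith
    · rcases eq_or_ne k (m + 1) with h' | h'
      · rw [if_neg h.ne', if_pos h', if_neg (by omega), if_neg (by omega), h']
        linarith
      · have hlt' : m + 1 < k := by omega
        rw [if_neg h.ne', if_neg h', if_neg (by omega), if_pos hlt', Nat.sub_sub,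
          Nat.cast_sub hlt'.le]
        have := hgt k hk hlt'
        push_cast
        rw [mul_one_div, ← sub_sub]
        linarith
  refine (Finset.sum_le_sum hle).trans ?_
  rw [Finset.sum_add_distrib, Finset.sum_add_distrib, Finset.sum_add_distrib,
    Finset.sum_ite_eq', Finset.sum_ite_eq', ← Finset.sum_filter, ← Finset.sum_filter,
    ← Finset.mul_sum, ← Finset.mul_sum]
  have e1 := sum_one_div_comp_le {k ∈ Finset.Icc 1 K | k < m} (fun k => m - k) K
    (fun k hk => by simp only [Finset.mem_filter, Finset.mem_Icc] at hk ⊢; omega)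
    (fun a ha b hb hab => by simp at ha hb hab; omega)
  have e2 := sum_one_div_comp_le {k ∈ Finset.Icc 1 K | m + 1 < k} (fun k => k - m - 1) K
    (fun k hk => by simp only [Finset.mem_filter, Finset.mem_Icc] at hk ⊢; omega)
    (fun a ha b hb hab => by simp at ha hb hab; omega)
  have e3 : (if m ∈ Finset.Icc 1 K then Q else 0) ≤ Q := by split_ifs <;> simp [hQ]
  have e4 : (if m + 1 ∈ Finset.Icc 1 K then Q else 0) ≤ Q := by split_ifs <;> simp [hQ]
  have e5 := mul_le_mul_of_nonneg_left e1 hR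
  have e6 := mul_le_mul_of_nonneg_left e2 hR
  linarith

theorem sum_one_div_abs_sub_le {h K : ℕ} (hK : h ≤ K) :
    ∑ k ∈ Finset.Icc 1 K, 1 / |(k : ℝ) - h| ≤ 2 + 2 * (1 + log K) := by
  have := sum_le_of_le_div_dist (f := fun k => 1 / |(k : ℝ) - h|) (Q := 1) (R := 1)
    zero_le_one zero_le_one hK (by simp) (by simp)
    (fun k _ hk => by
      have : (k : ℝ) < h := by exact_mod_cast hk
      rw [abs_of_neg (by linarith), neg_sub])
    (fun k _ hk => by
      have : (h : ℝ) + 1 < k := by exact_mod_cast hk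
      rw [abs_of_pos (by linarith)]
      exact one_div_le_one_div_of_le (by linarith) (by linarith))
  linarith

theorem sum_norm_stationary_sub_voronoiTerm_le {x ρ : ℝ} {h K : ℕ} (hx : 0 < x) (hh : 1 ≤ h)
    (hhρ : (h : ℝ) ^ 2 ≤ ρ) (hhK : h ≤ K) (hρK : ρ ≤ K) :
    ∑ k ∈ Finset.Icc 1 K, ‖(1 / h : ℝ) * (∫ t in (h * x / √ρ)..x,
        Complex.exp (Complex.I * (2 * π * (h * x ^ 2 / t + k * t) : ℝ)))
      - voronoiTerm x (h * k) * ((Real.sign ((k : ℝ) - h) - Real.sign (h * k - ρ) : ℝ) : ℂ)‖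
      ≤ 11 * (1 + log K) / h + 4 * √(x / √ρ) / √ρ := by
  have hh1 : (1 : ℝ) ≤ h := by exact_mod_cast hh
  have hh0 : (0 : ℝ) < h := by linarith
  have hρ : 0 < ρ := lt_of_lt_of_le (by positivity) hhρ
  have hlog : 0 ≤ log K := log_natCast_nonneg K
  set D : ℕ → ℝ := fun k => ‖(1 / h : ℝ) * (∫ t in (h * x / √ρ)..x,
        Complex.exp (Complex.I * (2 * π * (h * x ^ 2 / t + k * t) : ℝ)))
      - voronoiTerm x (h * k) * ((Real.sign ((k : ℝ) - h) - Real.sign (h * k - ρ) : ℝ) : ℂ)‖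
    with hD
  set m := ⌊ρ / h⌋₊ with hm
  have hhq : (h : ℝ) ≤ ρ / h := by rw [le_div_iff₀ hh0]; linarith
  have hmq : (m : ℝ) ≤ ρ / h := Nat.floor_le (by positivity)
  have hqm : ρ / h < m + 1 := Nat.lt_floor_add_one _
  have hm1 : (1 : ℝ) ≤ m := by
    exact_mod_cast (Nat.one_le_floor_iff _).mpr (hh1.trans hhq)
  have hmK : m ≤ K := by
    have : (m : ℝ) ≤ K := hmq.trans ((div_le_self hρ.le hh1).trans hρK)
    exact_mod_cast this
  have hm2 : ρ ≤ 2 * (h * m) := by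
    rw [div_lt_iff₀ hh0] at hqm
    nlinarith
  have hb : ∀ k : ℕ, m ≤ k → D k - 1 / h * (5 / k + 1 / |(k : ℝ) - h|) ≤
      2 * √(x / √ρ) / √ρ := fun k hk => by
    have hk' : (m : ℝ) ≤ k := by exact_mod_cast hk
    have := norm_stationary_sub_voronoiTerm_le_of_le hx hh0 (k := k) (by linarith) hρ hhρ
      (hm2.trans (by gcongr))
    linarith
  have ha : ∀ k ∈ Finset.Icc 1 K, D k - 1 / h * (5 / k + 1 / |(k : ℝ) - h|) ≤
      1 / h * (1 / |(k : ℝ) - ρ / h|) := fun k hk => by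
    have hk1 : (1 : ℝ) ≤ k := by exact_mod_cast (Finset.mem_Icc.mp hk).1
    have := norm_stationary_sub_voronoiTerm_le hx hh0 (k := k) (by linarith) hρ hhρ
    linarith
  have hsum := sum_le_of_le_div_dist (f := fun k => D k - 1 / h * (5 / k + 1 / |(k : ℝ) - h|))
    (m := m) (K := K) (Q := 2 * √(x / √ρ) / √ρ) (R := 1 / h) (by positivity) (by positivity) hmK
    (hb m le_rfl) (hb (m + 1) (by omega))
    (fun k hk hkm => by
      have hkm' : (k : ℝ) < m := by exact_mod_cast hkm
      refine (ha k hk).trans ?_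
      rw [div_eq_mul_one_div (1 / (h : ℝ)), abs_of_neg (by linarith)]
      exact mul_le_mul_of_nonneg_left (one_div_le_one_div_of_le (by linarith) (by linarith))
        (by positivity))
    (fun k hk hkm => by
      have hkm' : (m : ℝ) + 1 < k := by exact_mod_cast hkm
      refine (ha k hk).trans ?_
      rw [div_eq_mul_one_div (1 / (h : ℝ)), abs_of_pos (by linarith)]
      exact mul_le_mul_of_nonneg_left (one_div_le_one_div_of_le (by linarith) (by linarith))
        (by positivity))
  have h5 := sum_Icc_one_div_le K
  have h6 := sum_one_div_abs_sub_le hhK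
  have hsplit : ∑ k ∈ Finset.Icc 1 K, (1 / (h : ℝ)) * (5 / k + 1 / |(k : ℝ) - h|) =
      1 / h * (5 * ∑ k ∈ Finset.Icc 1 K, 1 / (k : ℝ) +
        ∑ k ∈ Finset.Icc 1 K, 1 / |(k : ℝ) - h|) := by
    rw [← Finset.mul_sum, Finset.sum_add_distrib,
      Finset.mul_sum (s := Finset.Icc 1 K) (a := (5 : ℝ))]
    simp only [mul_one_div]
  rw [Finset.sum_sub_distrib, hsplit] at hsum
  have h7 : 1 / (h : ℝ) * (5 * ∑ k ∈ Finset.Icc 1 K, 1 / (k : ℝ) +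
        ∑ k ∈ Finset.Icc 1 K, 1 / |(k : ℝ) - h|) ≤ 1 / h * (9 * (1 + log K)) := by
    gcongr
    linarith
  calc _ ≤ 1 / h * (9 * (1 + log K)) + (2 * (2 * √(x / √ρ) / √ρ) +
        2 * (1 / h) * (1 + log K)) := by linarith
    _ = _ := by ring

theorem norm_sum_exp_sub_voronoiTerm_le {x ρ : ℝ} {h K : ℕ} (hx : 1 ≤ x) (hh : 1 ≤ h)
    (hhρ : (h : ℝ) ^ 2 ≤ ρ) (hK : (ρ * (x + 1)) ^ 2 ≤ K) :
    ‖(1 / h : ℝ) * (∑ a ∈ Finset.Ioc ⌊h * x / √ρ⌋₊ ⌊x⌋₊,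
        Complex.exp (Complex.I * (2 * π * (h * x ^ 2 / a) : ℝ)))
      - ∑ k ∈ Finset.Icc 1 K, voronoiTerm x (h * k) *
        ((Real.sign ((k : ℝ) - h) - Real.sign (h * k - ρ) : ℝ) : ℂ)‖
      ≤ 72 * (1 + log K) / h + 4 * √(x / √ρ) / √ρ := by
  have hx0 : 0 < x := by linarith
  have hh1 : (1 : ℝ) ≤ h := by exact_mod_cast hh
  have hh0 : (0 : ℝ) < h := by linarith
  have hρ1 : 1 ≤ ρ := le_trans (by nlinarith) hhρ
  have hρ : 0 < ρ := by linarith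
  have hr0 : 0 < √ρ := sqrt_pos.mpr hρ
  have hρK : ρ ≤ K := by
    refine le_trans ?_ hK
    have : ρ ≤ ρ * (x + 1) := by nlinarith
    nlinarith
  have hhK : h ≤ K := by
    have : (h : ℝ) ≤ K := le_trans (by nlinarith) hρK
    exact_mod_cast this
  have hlog : 0 ≤ log K := log_natCast_nonneg K
  set A := h * x / √ρ with hA
  have hA0 : 0 < A := by positivity
  have hAB : A ≤ x := by
    rw [hA, div_le_iff₀ hr0, mul_comm]
    gcongr
    exact le_sqrt_of_sq_le hhρ
  have hpos : ∀ t ∈ Set.Icc A x, 0 < t := fun t ht => hA0.trans_le ht.1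
  have hne : ∀ t ∈ Set.Icc A x, t ≠ 0 := fun t ht => (hpos t ht).ne'
  set F : ℝ → ℂ := fun t => Complex.exp (Complex.I * (2 * π * (h * x ^ 2 / t) : ℝ)) with hF
  set F' : ℝ → ℂ := fun t => F t * (Complex.I * (2 * π * (h * x ^ 2 * (-(t ^ 2)⁻¹)) : ℝ))
    with hF'
  have hnormF : ∀ t, ‖F t‖ = 1 := fun t => by
    rw [hF]
    simp only
    rw [mul_comm, Complex.norm_exp_ofReal_mul_I]
  have hne2 : ∀ t ∈ Set.Icc A x, t ^ 2 ≠ 0 := fun t ht => pow_ne_zero 2 (hne t ht)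
  have hFc : ContinuousOn F (Set.Icc A x) := by
    rw [hF]
    fun_prop (disch := assumption)
  have hcos : ∀ k : ℕ, ContinuousOn
      (fun t : ℝ => Complex.exp (Complex.I * (2 * π * (h * x ^ 2 / t + k * t) : ℝ)))
      (Set.Icc A x) := fun k => by fun_prop (disch := assumption)
  have hcos' : ∀ k : ℕ, ContinuousOn
      (fun t : ℝ => Complex.exp (Complex.I * (2 * π * (h * x ^ 2 / t - k * t) : ℝ)))
      (Set.Icc A x) := fun k => by fun_prop (disch := assumption)
  have hP := norm_sum_sub_integral_dirichlet_kernel_le K hA0.le hAB (F := F) (F' := F')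
    (M := 2 * π * ρ)
    (fun t ht => by
      have h1 := (((hasDerivAt_inv (hne t ht)).const_mul (h * x ^ 2)).const_mul (2 * π))
      have h2 := (h1.ofReal_comp.const_mul Complex.I).cexp
      exact h2.congr_deriv (by simp only [hF', hF, div_eq_mul_inv]))
    (by
      rw [hF']
      fun_prop (disch := assumption))
    (fun t _ => (hnormF t).le)
    (fun t ht => by
      have ht0 := hpos t ht
      simp only [hF']
      rw [norm_mul, hnormF, one_mul, norm_mul, Complex.norm_I, one_mul, Complex.norm_real,
        norm_eq_abs, mul_neg, mul_neg, abs_neg, abs_of_nonneg (by positivity)]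
      gcongr
      rw [mul_inv_le_iff₀ (by positivity)]
      have e : A ^ 2 = h ^ 2 * x ^ 2 / ρ := by rw [hA, div_pow, sq_sqrt hρ.le, mul_pow]
      calc h * x ^ 2 ≤ h * x ^ 2 * h := le_mul_of_one_le_right (by positivity) hh1
        _ = ρ * A ^ 2 := by rw [e]; field_simp
        _ ≤ ρ * t ^ 2 := by gcongr; exact ht.1)
  have hPc : (6 : ℝ) + 2 * π * ρ * ((x + 1) * (8 / √(K + 1))) ≤ 59 := by
    have hs : ρ * (x + 1) ≤ √((K : ℝ) + 1) := le_sqrt_of_sq_le (by linarith)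
    have hs0 : 0 < √((K : ℝ) + 1) := sqrt_pos.mpr (by positivity)
    have e : 2 * π * ρ * ((x + 1) * (8 / √((K : ℝ) + 1))) =
        16 * π * (ρ * (x + 1) / √((K : ℝ) + 1)) := by ring
    have : ρ * (x + 1) / √((K : ℝ) + 1) ≤ 1 := by rwa [div_le_one hs0]
    rw [e]
    have : 16 * π * (ρ * (x + 1) / √((K : ℝ) + 1)) ≤ 16 * π * 1 := by gcongr
    linarith [pi_lt_d2]
  have hintg : ∀ {f : ℝ → ℂ}, ContinuousOn f (Set.Icc A x) →
      IntervalIntegrable f MeasureTheory.volume A x := fun hf =>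
    (hf.mono (Set.uIcc_of_le hAB).subset).intervalIntegrable
  have hI : ∫ t in A..x, F t * ((1 + ∑ k ∈ Finset.Icc 1 K, 2 * cos (2 * π * k * t) : ℝ) : ℂ) =
      (∫ t in A..x, F t) + ∑ k ∈ Finset.Icc 1 K,
        ((∫ t in A..x, Complex.exp (Complex.I * (2 * π * (h * x ^ 2 / t + k * t) : ℝ))) +
        ∫ t in A..x, Complex.exp (Complex.I * (2 * π * (h * x ^ 2 / t - k * t) : ℝ))) := by
    rw [Finset.sum_congr rfl fun k _ =>
      (intervalIntegral.integral_add (hintg (hcos k)) (hintg (hcos' k))).symm,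
      ← intervalIntegral.integral_finsetSum fun k _ => (hintg (hcos k)).add (hintg (hcos' k)),
      ← intervalIntegral.integral_add (hintg hFc) (hintg (continuousOn_finsetSum _ fun k _ =>
        (hcos k).fun_add (hcos' k)))]
    refine intervalIntegral.integral_congr fun t _ => ?_
    rw [Complex.ofReal_add, Complex.ofReal_one, Complex.ofReal_sum, mul_add, mul_one,
      Finset.mul_sum]
    congr 1
    refine Finset.sum_congr rfl fun k _ => ?_
    simp only [hF]
    rw [Complex.ofReal_mul 2 (cos _), Complex.ofReal_cos, Complex.ofReal_ofNat, Complex.two_cos,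
      mul_add (Complex.exp _), ← Complex.exp_add, ← Complex.exp_add]
    congr 2
    · push_cast; ring
    · push_cast; ring
  rw [hI] at hP
  have hJ0 : ‖∫ t in A..x, F t‖ ≤ 1 := by
    have := norm_integral_nonstationary_le hh0 (le_refl (0 : ℝ)) hA0 hAB
    simp only [zero_mul, sub_zero, add_zero] at this
    refine this.trans ?_
    rw [div_le_one hh0]
    exact hh1
  have hJneg : ‖∑ k ∈ Finset.Icc 1 K, ∫ t in A..x,
      Complex.exp (Complex.I * (2 * π * (h * x ^ 2 / t - k * t) : ℝ))‖ ≤ 1 + log K := by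
    refine (norm_sum_le_of_le _ fun k hk => ?_).trans (sum_Icc_one_div_le K)
    have hk1 : (1 : ℝ) ≤ k := by exact_mod_cast (Finset.mem_Icc.mp hk).1
    refine (norm_integral_nonstationary_le hh0 (by linarith) hA0 hAB).trans ?_
    gcongr
    linarith
  have hJpos := (norm_sum_le _ _).trans
    (sum_norm_stationary_sub_voronoiTerm_le hx0 hh hhρ hhK hρK)
  rw [Finset.sum_add_distrib] at hP
  rw [Finset.sum_sub_distrib, ← Finset.mul_sum] at hJpos
  set S := ∑ a ∈ Finset.Ioc ⌊A⌋₊ ⌊x⌋₊, F a with hS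
  set J0 := ∫ t in A..x, F t
  set Jm := ∑ k ∈ Finset.Icc 1 K, ∫ t in A..x,
      Complex.exp (Complex.I * (2 * π * (h * x ^ 2 / t - k * t) : ℝ))
  set Jp := ∑ k ∈ Finset.Icc 1 K, ∫ t in A..x,
      Complex.exp (Complex.I * (2 * π * (h * x ^ 2 / t + k * t) : ℝ))
  set V := ∑ k ∈ Finset.Icc 1 K, voronoiTerm x (h * k) *
        ((Real.sign ((k : ℝ) - h) - Real.sign (h * k - ρ) : ℝ) : ℂ)
  have hdec : ((1 / h : ℝ) : ℂ) * S - V =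
      ((1 / h : ℝ) : ℂ) * ((S - (J0 + (Jp + Jm))) + J0 + Jm) + (((1 / h : ℝ) : ℂ) * Jp - V) := by
    ring
  rw [hdec]
  calc _ ≤ 1 / h * (59 + 1 + (1 + log K)) + (11 * (1 + log K) / h + 4 * √(x / √ρ) / √ρ) := by
        refine (norm_add_le _ _).trans (add_le_add ?_ hJpos)
        rw [norm_mul, Complex.norm_real, norm_of_nonneg (by positivity)]
        gcongr
        exact (norm_add₃_le).trans (by linarith)
    _ ≤ 1 / h * (61 * (1 + log K)) + (11 * (1 + log K) / h + 4 * √(x / √ρ) / √ρ) := by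
        gcongr
        linarith
    _ = _ := by ring

theorem voronoiTerm_im (x n : ℝ) : (voronoiTerm x n).im =
    √x / (2 * √2) * (n ^ (-(3 : ℝ) / 4) * cos (4 * π * √n * x - π / 4)) := by
  rw [voronoiTerm, Complex.im_ofReal_mul, mul_comm Complex.I, Complex.exp_ofReal_mul_I_im,
    mul_assoc, show 4 * π * √n * x - π / 4 = 4 * π * √n * x + π / 4 - π / 2 by ring,
    cos_sub_pi_div_two]

theorem sum_voronoiTerm_mul_sign_sub_sign (x : ℝ) {h N K : ℕ} (hh : 1 ≤ h) (hN : h ≤ N.sqrt)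
    (hK : N ≤ K) :
    ∑ k ∈ Finset.Icc 1 K, voronoiTerm x (h * k) *
        ((Real.sign ((k : ℝ) - h) - Real.sign (h * k - (N + 1 / 2)) : ℝ) : ℂ) =
      ∑ k ∈ Finset.Icc 1 (N / h), voronoiTerm x ((h * k : ℕ) : ℝ) *
        ((1 + Real.sign ((k : ℝ) - h) : ℝ) : ℂ) := by
  have hhN : h ≤ N / h := by
    rw [Nat.le_div_iff_mul_le hh]
    exact Nat.le_sqrt.mp hN
  symm
  rw [Finset.sum_congr rfl (g := fun k : ℕ => voronoiTerm x (h * k) *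
        ((Real.sign ((k : ℝ) - h) - Real.sign (h * k - (N + 1 / 2)) : ℝ) : ℂ)) fun k hk => ?_]
  · refine Finset.sum_subset
      (Finset.Icc_subset_Icc_right ((Nat.div_le_self N h).trans hK)) fun k hk hk' => ?_
    simp only [Finset.mem_Icc, not_and, not_le] at hk hk'
    have hk1 := hk' hk.1
    have hhk : (h : ℝ) < k := by exact_mod_cast hhN.trans_lt hk1
    have hNk : (N : ℝ) + 1 ≤ h * k := by
      rw [Nat.div_lt_iff_lt_mul hh, mul_comm] at hk1
      exact_mod_cast hk1
    rw [Real.sign_of_pos (by linarith), Real.sign_of_pos (by linarith)]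
    simp
  · have hNk : (h * k : ℝ) ≤ N := by
      have := (Nat.mul_le_mul_left h (Finset.mem_Icc.mp hk).2).trans (Nat.mul_div_le N h)
      exact_mod_cast this
    rw [Real.sign_of_neg (show (h * k : ℝ) - (N + 1 / 2) < 0 by linarith), sub_neg_eq_add,
      add_comm (1 : ℝ)]
    push_cast
    rfl

theorem abs_sum_sin_sub_voronoi_le {x : ℝ} {N K : ℕ} (hx : 1 ≤ x)
    (hK : (((N : ℝ) + 1 / 2) * (x + 1)) ^ 2 ≤ K) :
    |∑ h ∈ Finset.Icc 1 N.sqrt, 1 / (h : ℝ) *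
        (∑ a ∈ Finset.Ioc ⌊h * x / √((N : ℝ) + 1 / 2)⌋₊ ⌊x⌋₊, sin (2 * π * (h * x ^ 2 / a)))
      - √x / (2 * √2) * ∑ n ∈ Finset.Icc 1 N, (n.divisors.card : ℝ) * (n : ℝ) ^ (-(3 : ℝ) / 4) *
        cos (4 * π * √n * x - π / 4)|
      ≤ 72 * (1 + log K) * (1 + log N.sqrt) + 4 * √(x / √((N : ℝ) + 1 / 2)) := by
  set ρ : ℝ := (N : ℝ) + 1 / 2 with hρdef
  have hρ : 0 < ρ := by positivity
  have hsq : ((N.sqrt : ℕ) : ℝ) ^ 2 ≤ ρ := by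
    have : ((N.sqrt : ℕ) : ℝ) ^ 2 ≤ N := by exact_mod_cast Nat.sqrt_le' N
    linarith
  have hNK : N ≤ K := by
    have : (N : ℝ) ≤ K := by
      refine le_trans ?_ hK
      have : ρ * 2 ≤ ρ * (x + 1) := by gcongr; linarith
      nlinarith
    exact_mod_cast this
  have hV : √x / (2 * √2) * ∑ n ∈ Finset.Icc 1 N, (n.divisors.card : ℝ) *
      (n : ℝ) ^ (-(3 : ℝ) / 4) * cos (4 * π * √n * x - π / 4) =
      ∑ h ∈ Finset.Icc 1 N.sqrt, (∑ k ∈ Finset.Icc 1 K, voronoiTerm x (h * k) *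
        ((Real.sign ((k : ℝ) - h) - Real.sign (h * k - ρ) : ℝ) : ℂ)).im := by
    have h1 := sum_card_divisors_mul_eq_sum_sqrt N fun n => (voronoiTerm x n).im
    rw [Finset.mul_sum, Finset.sum_congr rfl (g := fun n : ℕ =>
      (n.divisors.card : ℝ) * (voronoiTerm x n).im) fun n _ => by rw [voronoiTerm_im]; ring, h1]
    refine Finset.sum_congr rfl fun h hh => ?_
    rw [Finset.mem_Icc] at hh
    rw [hρdef, sum_voronoiTerm_mul_sign_sub_sign x hh.1 hh.2 hNK, Complex.im_sum]
    exact Finset.sum_congr rfl fun k _ => by rw [Complex.im_mul_ofReal]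
  have hS : ∀ h : ℕ, 1 / (h : ℝ) *
      (∑ a ∈ Finset.Ioc ⌊h * x / √ρ⌋₊ ⌊x⌋₊, sin (2 * π * (h * x ^ 2 / a))) =
      ((1 / h : ℝ) * (∑ a ∈ Finset.Ioc ⌊h * x / √ρ⌋₊ ⌊x⌋₊,
        Complex.exp (Complex.I * (2 * π * (h * x ^ 2 / a) : ℝ)))).im := fun h => by
    rw [Complex.im_ofReal_mul, Complex.im_sum]
    congr 1
    exact Finset.sum_congr rfl fun a _ => by rw [mul_comm Complex.I, Complex.exp_ofReal_mul_I_im]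
  rw [hV, Finset.sum_congr rfl fun h _ => hS h, ← Finset.sum_sub_distrib]
  refine (Finset.abs_sum_le_sum_abs _ _).trans ?_
  calc _ ≤ ∑ h ∈ Finset.Icc 1 N.sqrt, (72 * (1 + log K) / (h : ℝ) + 4 * √(x / √ρ) / √ρ) := by
        refine Finset.sum_le_sum fun h hh => ?_
        rw [Finset.mem_Icc] at hh
        rw [← Complex.sub_im]
        refine (Complex.abs_im_le_norm _).trans
          (norm_sum_exp_sub_voronoiTerm_le hx hh.1 (le_trans ?_ hsq) hK)
        gcongr
        exact hh.2
    _ = 72 * (1 + log K) * (∑ h ∈ Finset.Icc 1 N.sqrt, 1 / (h : ℝ)) +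
        N.sqrt * (4 * √(x / √ρ) / √ρ) := by
        rw [Finset.sum_add_distrib, Finset.mul_sum, Finset.sum_const, Nat.card_Icc,
          Nat.add_sub_cancel, nsmul_eq_mul]
        simp only [mul_one_div]
    _ ≤ 72 * (1 + log K) * (1 + log N.sqrt) + √ρ * (4 * √(x / √ρ) / √ρ) := by
        gcongr
        · exact sum_Icc_one_div_le _
        · exact le_sqrt_of_sq_le hsq
    _ = _ := by
        congr 1
        field_simp

theorem sum_sawtoothSum_eq {x : ℝ} {N : ℕ} (hx : 1 ≤ x) :
    ∑ a ∈ Finset.Icc 1 ⌊x⌋₊,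
        sawtoothSum (⌈a * (√((N : ℝ) + 1 / 2) / x)⌉₊ - 1) (x ^ 2 / a) =
      1 / π * ∑ h ∈ Finset.Icc 1 N.sqrt, 1 / (h : ℝ) *
        (∑ a ∈ Finset.Ioc ⌊h * x / √((N : ℝ) + 1 / 2)⌋₊ ⌊x⌋₊,
          sin (2 * π * (h * x ^ 2 / a))) := by
  set ρ : ℝ := (N : ℝ) + 1 / 2 with hρdef
  have hx0 : 0 < x := by linarith
  have hρ : 0 < ρ := by positivity
  have hr0 : 0 < √ρ := sqrt_pos.mpr hρ
  simp only [sawtoothSum, Finset.mul_sum]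
  rw [Finset.sum_comm' (t' := Finset.Icc 1 N.sqrt)
    (s' := fun h => Finset.Ioc ⌊h * x / √ρ⌋₊ ⌊x⌋₊)]
  · refine Finset.sum_congr rfl fun h _ => Finset.sum_congr rfl fun a _ => ?_
    rw [show 2 * π * (h * x ^ 2 / a) = 2 * π * h * (x ^ 2 / a) by ring]
    ring
  · intro a h
    have hiff : h ≤ ⌈a * (√ρ / x)⌉₊ - 1 ∧ 1 ≤ h ↔ (h : ℝ) < a * (√ρ / x) ∧ 1 ≤ h := by
      rw [← Nat.lt_ceil]
      omega
    have hiff2 : (h : ℝ) < a * (√ρ / x) ↔ ⌊h * x / √ρ⌋₊ < a := by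
      rw [Nat.floor_lt (by positivity), div_lt_iff₀ hr0, ← mul_div_assoc, lt_div_iff₀ hx0]
    simp only [Finset.mem_Icc, Finset.mem_Ioc]
    constructor
    · rintro ⟨⟨ha, hax⟩, hh, hK⟩
      have h1 := (hiff.mp ⟨hK, hh⟩).1
      refine ⟨⟨hiff2.mp h1, hax⟩, hh, Nat.le_sqrt'.mpr ?_⟩
      have hax' : (a : ℝ) ≤ x := (Nat.cast_le.mpr hax).trans (Nat.floor_le hx0.le)
      have h2 : (h : ℝ) < √ρ := by
        refine h1.trans_le ?_
        calc (a : ℝ) * (√ρ / x) ≤ x * (√ρ / x) := by gcongr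
          _ = √ρ := by field_simp
      have h3 : (h : ℝ) ^ 2 < ρ := (lt_sqrt (by positivity)).mp h2
      have h4 : (h : ℝ) ^ 2 < N + 1 := by linarith
      exact Nat.lt_succ_iff.mp (by exact_mod_cast h4)
    · rintro ⟨⟨ha, hax⟩, hh, -⟩
      exact ⟨⟨by omega, hax⟩, hh, (hiff.mpr ⟨hiff2.mpr ha, hh⟩).1⟩

theorem sum_abs_sawtoothError_le {x θ D : ℝ} (hx : 1 ≤ x) (hθ : 0 < θ)
    (hD : ∀ n : ℕ, 1 ≤ n → (n : ℝ) ≤ 2 * x ^ 2 → (n.divisors.card : ℝ) ≤ D) :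
    ∑ a ∈ Finset.Icc 1 ⌊x⌋₊, |sawtoothError (⌈a * θ⌉₊ - 1) (x ^ 2 / a)| ≤
      6 * D + 2 * (D / θ) * (1 + log ⌊2 * x ^ 2⌋₊) := by
  have hx0 : 0 < x := by linarith
  have hD1 : 1 ≤ D := by simpa using hD 1 le_rfl (by push_cast; nlinarith)
  set e : ℕ → ℝ := fun a => |sawtoothError (⌈a * θ⌉₊ - 1) (x ^ 2 / a)| with he
  set ν : ℕ → ℕ := fun a => a * (round (x ^ 2 / (a : ℝ))).toNat with hν
  have hround : ∀ a ∈ Finset.Icc 1 ⌊x⌋₊, (1 : ℝ) ≤ a ∧ (a : ℝ) ≤ x ∧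
      0 < round (x ^ 2 / (a : ℝ)) ∧
      (ν a : ℝ) = a * (round (x ^ 2 / (a : ℝ)) : ℝ) := fun a ha => by
    rw [Finset.mem_Icc] at ha
    have ha1 : (1 : ℝ) ≤ a := by exact_mod_cast ha.1
    have hax : (a : ℝ) ≤ x := (Nat.cast_le.mpr ha.2).trans (Nat.floor_le hx0.le)
    have h1 : 1 ≤ x ^ 2 / (a : ℝ) := by
      rw [le_div_iff₀ (by linarith)]
      nlinarith
    have h2 : 0 < round (x ^ 2 / (a : ℝ)) := by
      have := abs_le.mp (abs_sub_round (x ^ 2 / (a : ℝ)))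
      have h3 : (0 : ℝ) < round (x ^ 2 / (a : ℝ)) := by linarith
      exact_mod_cast h3
    refine ⟨ha1, hax, h2, ?_⟩
    have h4 : (((round (x ^ 2 / (a : ℝ))).toNat : ℤ) : ℝ) = round (x ^ 2 / (a : ℝ)) := by
      rw [Int.toNat_of_nonneg h2.le]
    rw [hν]
    push_cast at h4 ⊢
    rw [h4]
  have hdist : ∀ a ∈ Finset.Icc 1 ⌊x⌋₊,
      |x ^ 2 - ν a| = a * |x ^ 2 / a - round (x ^ 2 / (a : ℝ))| := fun a ha => by
    obtain ⟨ha1, -, -, h⟩ := hround a ha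
    have ha0 : (0 : ℝ) < a := by linarith
    rw [h, ← abs_of_pos ha0, ← abs_mul, abs_of_pos ha0, mul_sub]
    congr 2
    field_simp
  have hmaps : ∀ a ∈ Finset.Icc 1 ⌊x⌋₊, ν a ∈ Finset.Icc 1 ⌊2 * x ^ 2⌋₊ := fun a ha => by
    obtain ⟨ha1, hax, hr, h⟩ := hround a ha
    rw [Finset.mem_Icc, Nat.le_floor_iff (by positivity)]
    refine ⟨Nat.mul_pos (Finset.mem_Icc.mp ha).1 (by omega), ?_⟩
    have h1 := hdist a ha
    have h2 : (a : ℝ) * |x ^ 2 / a - round (x ^ 2 / (a : ℝ))| ≤ a * (1 / 2) := by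
      gcongr
      exact abs_sub_round _
    have h3 := abs_le.mp (h1.le.trans h2)
    nlinarith
  have hcard : ∀ n ∈ Finset.Icc 1 ⌊2 * x ^ 2⌋₊,
      (({a ∈ Finset.Icc 1 ⌊x⌋₊ | ν a = n}.card : ℕ) : ℝ) ≤ D := fun n hn => by
    rw [Finset.mem_Icc, Nat.le_floor_iff (by positivity)] at hn
    refine le_trans ?_ (hD n hn.1 hn.2)
    refine Nat.cast_le.mpr (Finset.card_le_card fun a ha => ?_)
    rw [Finset.mem_filter] at ha
    rw [Nat.mem_divisors]
    exact ⟨⟨_, ha.2.symm⟩, by omega⟩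
  have hf : ∀ n ∈ Finset.Icc 1 ⌊2 * x ^ 2⌋₊, ∀ b : ℝ, 0 ≤ b →
      (∀ a ∈ Finset.Icc 1 ⌊x⌋₊, ν a = n → e a ≤ b) →
      ∑ a ∈ Finset.Icc 1 ⌊x⌋₊ with ν a = n, e a ≤ D * b := fun n hn b hb h => by
    refine (Finset.sum_le_card_nsmul _ _ b fun a ha => ?_).trans ?_
    · rw [Finset.mem_filter] at ha
      exact h a ha.1 ha.2
    · rw [nsmul_eq_mul]
      gcongr
      exact hcard n hn
  have hdec : ∀ a ∈ Finset.Icc 1 ⌊x⌋₊, e a * (θ * |x ^ 2 - ν a|) ≤ 1 := fun a ha => by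
    obtain ⟨ha1, -, -, -⟩ := hround a ha
    rw [hdist a ha]
    refine le_trans ?_ (abs_sawtoothError_mul_le (⌈a * θ⌉₊ - 1) (x ^ 2 / a))
    rw [show θ * (a * |x ^ 2 / a - round (x ^ 2 / (a : ℝ))|) =
      a * θ * |x ^ 2 / a - round (x ^ 2 / (a : ℝ))| by ring]
    simp only [he]
    gcongr
    have h1 : 1 ≤ ⌈a * θ⌉₊ := Nat.one_le_ceil_iff.mpr (by positivity)
    rw [Nat.cast_sub h1, Nat.cast_one, sub_add_cancel]
    exact Nat.le_ceil _
  have hdec' : ∀ a ∈ Finset.Icc 1 ⌊x⌋₊, ∀ δ : ℝ, 0 < δ → δ ≤ |x ^ 2 - ν a| →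
      e a ≤ 1 / θ / δ := fun a ha δ hδ h => by
    rw [div_div, le_div_iff₀ (by positivity)]
    refine le_trans ?_ (hdec a ha)
    simp only [he]
    gcongr
  set m := ⌊x ^ 2⌋₊ with hm
  have hm1 : (m : ℝ) ≤ x ^ 2 := Nat.floor_le (by positivity)
  have hm2 : x ^ 2 < m + 1 := Nat.lt_floor_add_one _
  have h3 : ∀ n : ℕ, ∑ a ∈ Finset.Icc 1 ⌊x⌋₊ with ν a = n, e a ≤ 3 * D := fun n => by
    by_cases hn : n ∈ Finset.Icc 1 ⌊2 * x ^ 2⌋₊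
    · rw [mul_comm]
      exact hf n hn 3 (by norm_num) fun a _ _ => abs_sawtoothError_le _ _
    · have hempty : {a ∈ Finset.Icc 1 ⌊x⌋₊ | ν a = n} = ∅ :=
        Finset.filter_eq_empty_iff.mpr fun a ha h => hn (h ▸ hmaps a ha)
      rw [hempty, Finset.sum_empty]
      linarith
  rw [← Finset.sum_fiberwise_of_maps_to hmaps]
  have := sum_le_of_le_div_dist (f := fun n => ∑ a ∈ Finset.Icc 1 ⌊x⌋₊ with ν a = n, e a)
    (m := m) (K := ⌊2 * x ^ 2⌋₊) (Q := 3 * D) (R := D / θ) (by positivity) (by positivity)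
    (Nat.floor_mono (by nlinarith)) (h3 _) (h3 _)
    (fun n hn hlt => by
      have hlt' : (n : ℝ) < m := by exact_mod_cast hlt
      have h0 : 0 < (m : ℝ) - n := by linarith
      refine (hf n hn (1 / θ / ((m : ℝ) - n)) (by positivity) fun a ha h => ?_).trans
        (le_of_eq (by ring))
      refine hdec' a ha _ h0 ?_
      rw [h, abs_of_pos (by linarith)]
      linarith)
    (fun n hn hlt => by
      have hlt' : (m : ℝ) + 1 < n := by exact_mod_cast hlt
      have h0 : 0 < (n : ℝ) - m - 1 := by linarith
      refine (hf n hn (1 / θ / ((n : ℝ) - m - 1)) (by positivity) fun a ha h => ?_).trans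
        (le_of_eq (by ring))
      refine hdec' a ha _ h0 ?_
      rw [h, abs_of_neg (by linarith)]
      linarith)
  linarith

theorem abs_divisorError_sub_voronoi_le {x D : ℝ} {N K : ℕ} (hx : 1 ≤ x)
    (hK : (((N : ℝ) + 1 / 2) * (x + 1)) ^ 2 ≤ K)
    (hD : ∀ n : ℕ, 1 ≤ n → (n : ℝ) ≤ 2 * x ^ 2 → (n.divisors.card : ℝ) ≤ D) :
    |divisorError (x ^ 2) - (√x / (π * √2)) * ∑ n ∈ Finset.Icc 1 N,
        (n.divisors.card : ℝ) * (n : ℝ) ^ (-(3 : ℝ) / 4) * cos (4 * π * √n * x - π / 4)| ≤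
      40 + 2 * (6 * D + 2 * (D * (x / √((N : ℝ) + 1 / 2))) * (1 + log ⌊2 * x ^ 2⌋₊)) +
        (72 * (1 + log K) * (1 + log N.sqrt) + 4 * √(x / √((N : ℝ) + 1 / 2))) := by
  set ρ : ℝ := (N : ℝ) + 1 / 2 with hρdef
  have hρ : 0 < ρ := by positivity
  have h1 := abs_divisorError_add_sum_fract_le hx
  have h2 := sum_abs_sawtoothError_le (θ := √ρ / x) hx (by positivity) hD
  have h3 := abs_sum_sin_sub_voronoi_le hx hK
  have h4 := sum_sawtoothSum_eq (N := N) hx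
  rw [← hρdef] at h3 h4
  rw [div_div_eq_mul_div, mul_div_assoc] at h2
  set T := ∑ h ∈ Finset.Icc 1 N.sqrt, 1 / (h : ℝ) *
        (∑ a ∈ Finset.Ioc ⌊h * x / √ρ⌋₊ ⌊x⌋₊, sin (2 * π * (h * x ^ 2 / a)))
  set V := ∑ n ∈ Finset.Icc 1 N, (n.divisors.card : ℝ) * (n : ℝ) ^ (-(3 : ℝ) / 4) *
    cos (4 * π * √n * x - π / 4)
  set E := ∑ a ∈ Finset.Icc 1 ⌊x⌋₊, sawtoothError (⌈a * (√ρ / x)⌉₊ - 1) (x ^ 2 / a) with hE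
  have hE' : |E| ≤ _ := (Finset.abs_sum_le_sum_abs _ _).trans h2
  have hsplit : ∑ a ∈ Finset.Icc 1 ⌊x⌋₊, (Int.fract (x ^ 2 / a) - 1 / 2) = E - 1 / π * T := by
    rw [hE, ← h4, ← Finset.sum_sub_distrib]
    exact Finset.sum_congr rfl fun a _ => by rw [sawtoothError]; ring
  rw [hsplit] at h1
  have hdec : divisorError (x ^ 2) - √x / (π * √2) * V =
      (divisorError (x ^ 2) + 2 * (E - 1 / π * T)) + -(2 * E) +
        2 / π * (T - √x / (2 * √2) * V) := by
    field_simp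
    ring
  have hπ : 2 / π ≤ 1 := by
    rw [div_le_one pi_pos]
    linarith [pi_gt_three]
  rw [hdec]
  refine (abs_add_three _ _ _).trans ?_
  rw [abs_neg, abs_mul, abs_two, abs_mul, abs_of_pos (show 0 < 2 / π by positivity)]
  have h5 : 2 / π * |T - √x / (2 * √2) * V| ≤ 1 * |T - √x / (2 * √2) * V| := by gcongr
  linarith

theorem log_le_mul_rpow {x δ : ℝ} (hx : 1 ≤ x) (hδ : 0 < δ) {a b : ℝ} (ha : 0 ≤ a) (hb : 0 ≤ b) :
    a + b * log x ≤ (a + b / δ) * x ^ δ := by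
  have h1 := log_le_rpow_div (by linarith : 0 ≤ x) hδ
  have h2 : 1 ≤ x ^ δ := one_le_rpow hx hδ.le
  calc a + b * log x ≤ a * x ^ δ + b * (x ^ δ / δ) := by
        gcongr
        exact le_mul_of_one_le_right ha h2
    _ = _ := by ring

/-- Truncated Voronoï summation formula for the divisor function. -/
theorem voronoi_divisor_truncated :
    ∀ ε : ℝ, 0 < ε → ∃ Cε : ℝ, 0 < Cε ∧
      ∀ x : ℝ, 1 ≤ x → ∀ N : ℕ, 1 ≤ N → (N : ℝ) ≤ x ^ 2 →
        |divisorError (x ^ 2) -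
            (Real.sqrt x / (π * Real.sqrt 2)) * ∑ n ∈ Finset.Icc 1 N,
              ((Nat.divisors n).card : ℝ) * (n : ℝ) ^ (-(3 : ℝ) / 4) *
                Real.cos (4 * π * Real.sqrt n * x - π / 4)|
          ≤ Cε * (N : ℝ) ^ (-(1 : ℝ) / 2) * x ^ (1 + ε) := by
  intro ε hε
  obtain ⟨C, hC1, hC⟩ := exists_card_divisors_le_rpow (ε := ε / 4) (by positivity)
  set δ := ε / 2 with hδ
  have hδ0 : 0 < δ := by positivity
  set B := C * 2 ^ (ε / 4) with hB
  refine ⟨40 + 2 * (6 * B + 2 * B * (2 + 2 / δ)) + (72 * ((4 + 6 / δ) * (1 + 1 / δ)) + 4),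
    by positivity, fun x hx N hN hNx => ?_⟩
  have hx0 : 0 < x := by linarith
  have hN1 : (1 : ℝ) ≤ N := by exact_mod_cast hN
  have hN0 : (0 : ℝ) < N := by linarith
  set X := x ^ δ with hX
  have hX1 : 1 ≤ X := one_le_rpow hx hδ0.le
  have hXX : x ^ ε = X * X := by
    rw [hX, ← rpow_add hx0, hδ]
    congr 1
    ring
  set K := ⌈(((N : ℝ) + 1 / 2) * (x + 1)) ^ 2⌉₊ with hK
  have hK0 : 0 < (((N : ℝ) + 1 / 2) * (x + 1)) ^ 2 := by positivity
  have hK1 : 1 ≤ K := Nat.one_le_ceil_iff.mpr hK0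
  have hD : ∀ n : ℕ, 1 ≤ n → (n : ℝ) ≤ 2 * x ^ 2 → (n.divisors.card : ℝ) ≤ B * X :=
    fun n hn hnx => by
    refine (hC n hn).trans ?_
    have e : B * X = C * (2 * x ^ 2) ^ (ε / 4) := by
      rw [mul_rpow two_pos.le (by positivity), ← rpow_natCast x 2, ← rpow_mul hx0.le, hB, hX, hδ,
        mul_assoc]
      congr 3
      push_cast
      ring
    rw [e]
    gcongr
  have hKlog : 1 + log K ≤ (4 + 6 / δ) * X := by
    refine le_trans ?_ (log_le_mul_rpow hx hδ0 (by norm_num) (by norm_num))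
    have h1 : (K : ℝ) ≤ 10 * x ^ 6 := by
      have h2 := (Nat.ceil_lt_add_one hK0.le).le
      have h3 : ((N : ℝ) + 1 / 2) * (x + 1) ≤ (3 / 2 * x ^ 2) * (2 * x) := by
        gcongr <;> linarith
      have h4 : (((N : ℝ) + 1 / 2) * (x + 1)) ^ 2 ≤ ((3 / 2 * x ^ 2) * (2 * x)) ^ 2 := by gcongr
      have h5 : (1 : ℝ) ≤ x ^ 6 := one_le_pow₀ hx
      nlinarith
    have h10 : log 10 ≤ 3 := by
      rw [log_le_iff_le_exp (by norm_num)]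
      have := exp_one_gt_d9
      calc (10 : ℝ) ≤ 2.7 ^ 3 := by norm_num
        _ ≤ exp 1 ^ 3 := by gcongr; linarith
        _ = exp 3 := by rw [← exp_nat_mul]; norm_num
    have h2 : log K ≤ log (10 * x ^ 6) := log_le_log (by exact_mod_cast hK1) h1
    rw [log_mul (by norm_num) (by positivity), log_pow] at h2
    push_cast at h2
    linarith
  have hfl : 1 + log ⌊2 * x ^ 2⌋₊ ≤ (2 + 2 / δ) * X := by
    refine le_trans ?_ (log_le_mul_rpow hx hδ0 (by norm_num) (by norm_num))
    have h1 : 1 ≤ ⌊2 * x ^ 2⌋₊ := (Nat.one_le_floor_iff _).mpr (by linarith)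
    have h2 : log ⌊2 * x ^ 2⌋₊ ≤ log (2 * x ^ 2) :=
      log_le_log (by exact_mod_cast h1) (Nat.floor_le (by positivity))
    rw [log_mul (by norm_num) (by positivity), log_pow] at h2
    push_cast at h2
    linarith [log_two_lt_d9]
  have hsq : 1 + log N.sqrt ≤ (1 + 1 / δ) * X := by
    refine le_trans ?_ (log_le_mul_rpow hx hδ0 (by norm_num) (by norm_num))
    have h1 : 1 ≤ N.sqrt := Nat.le_sqrt.mpr (by simpa using hN)
    have h2 : ((N.sqrt : ℕ) : ℝ) ≤ x := by
      have : ((N.sqrt : ℕ) : ℝ) ^ 2 ≤ N := by exact_mod_cast Nat.sqrt_le' N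
      exact abs_le_of_sq_le_sq' (this.trans hNx) hx0.le |>.2
    have h3 : log N.sqrt ≤ log x := log_le_log (by exact_mod_cast h1) h2
    linarith
  have hmain := abs_divisorError_sub_voronoi_le (N := N) (K := K) hx (Nat.le_ceil _) hD
  refine hmain.trans ?_
  set Z := x / √N with hZ
  have hsN : 0 < √(N : ℝ) := sqrt_pos.mpr hN0
  have hZ1 : 1 ≤ Z := by
    rw [hZ, one_le_div hsN]
    exact sqrt_le_iff.mpr ⟨hx0.le, hNx⟩
  have hYZ : x / √((N : ℝ) + 1 / 2) ≤ Z := by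
    rw [hZ]
    gcongr
    linarith
  have hsY : √(x / √((N : ℝ) + 1 / 2)) ≤ Z := by
    refine sqrt_le_iff.mpr ⟨by linarith, ?_⟩
    nlinarith
  have hrhs : ∀ A : ℝ, A * (N : ℝ) ^ (-(1 : ℝ) / 2) * x ^ (1 + ε) = A * (Z * (X * X)) :=
    fun A => by
    rw [rpow_add hx0, rpow_one, hXX, hZ, sqrt_eq_rpow, neg_div, rpow_neg hN0.le]
    ring
  have hZX : Z ≤ Z * (X * X) := le_mul_of_one_le_right (by linarith)
    (one_le_mul_of_one_le_of_one_le hX1 hX1)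
  have hXXZ : X * X ≤ Z * (X * X) := le_mul_of_one_le_left (by positivity) hZ1
  have hXZ : X ≤ Z * (X * X) := (le_mul_of_one_le_left (by linarith) hX1).trans hXXZ
  rw [hrhs]
  calc _ ≤ 40 + 2 * (6 * (B * X) + 2 * (B * X * Z) * ((2 + 2 / δ) * X)) +
        (72 * ((4 + 6 / δ) * X) * ((1 + 1 / δ) * X) + 4 * Z) := by gcongr
    _ = 40 * 1 + 2 * (6 * (B * X) + 2 * B * (2 + 2 / δ) * (Z * (X * X))) +
        (72 * ((4 + 6 / δ) * (1 + 1 / δ)) * (X * X) + 4 * Z) := by ring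
    _ ≤ 40 * (Z * (X * X)) +
        2 * (6 * (B * (Z * (X * X))) + 2 * B * (2 + 2 / δ) * (Z * (X * X))) +
        (72 * ((4 + 6 / δ) * (1 + 1 / δ)) * (Z * (X * X)) + 4 * (Z * (X * X))) := by
        gcongr
        exact hZ1.trans hZX
    _ = _ := by ring
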